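/- There is a computable function F : ℚ × ℚ × ℚ × ℚ × ℚ × ℚ × ℚ × ℚ → Bool such that for all rationals a1, b1, a2, b2, c, x0, u, v: if the two-interval PAM f defined by a1, b1, a2, b2, c maps [0,1) ∩ ℚ into [0,1) ∩ ℚ, is injective on [0,1) ∩ ℚ, x0 ∈ [0,1) ∩ ℚ, and 0 ≤ u < v ≤ 1, then F (a1, b1, a2, b2, c, x0, u, v) = true if and only if there exists n : ℕ with u ≤ f^[n] x0 and f^[n] x0 < v. (Point-to-interval reachability is decidable for injective two-interval PAM.) -/

import Mathlib

/-- The two-interval piecewise affine map on `[0,1) ∩ ℚ` given by rationals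
`a1, b1, a2, b2, c`. -/
def pam2 (a1 b1 a2 b2 c : ℚ) (x : ℚ) : ℚ :=
  if 0 ≤ x ∧ x < c then a1 * x + b1
  else if c ≤ x ∧ x < 1 then a2 * x + b2
  else 0

/-- total unbounded search is computable -/
theorem computable_find {α : Type*} [Primcodable α] (p : α → ℕ → Bool) (hp : Computable₂ p)
    (h : ∀ a, ∃ n, p a n = true) : Computable (fun a => Nat.find (h a)) := by
  have h1 : Partrec₂ (fun (a : α) (n : ℕ) => (Part.some (p a n) : Part Bool)) := hp.partrec₂
  have h2 := Partrec.rfind h1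
  refine h2.of_eq_tot (fun a => ?_)
  refine Nat.mem_rfind.2 ⟨?_, ?_⟩
  · simpa using (Nat.find_spec (h a)).symm
  · intro m hm
    have := Nat.find_min (h a) hm
    simp at this
    simp [this]

/-- structural code of a rational -/
def ratCode (q : ℚ) : ℕ := @Encodable.encode ℚ Rat.instEncodable q

theorem ratCode_eq (q : ℚ) : ratCode q = Nat.pair (Encodable.encode q.num) q.den := by
  rfl

theorem int_encode_nonneg (n : ℕ) : Encodable.encode (n : ℤ) = 2 * n := by
  rfl

theorem int_encode_neg (n : ℕ) : Encodable.encode (Int.negSucc n) = 2 * n + 1 := by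
  rfl

theorem ratCode_ofNat_succ (n : ℕ) :
    ∃ h : ∃ m, ratCode (Denumerable.ofNat ℚ n) + m + 1 ∈ Set.range ratCode, ∃ (_ : DecidablePred (fun m => ratCode (Denumerable.ofNat ℚ n) + m + 1 ∈ Set.range ratCode)), 
    ratCode (Denumerable.ofNat ℚ (n+1)) = ratCode (Denumerable.ofNat ℚ n) + Nat.find h + 1 := by
  classical
  let _ := @Encodable.decidableRangeEncode ℚ _
  have : Infinite (Set.range (@Encodable.encode ℚ _)) :=
    Infinite.of_injective _ (Equiv.ofInjective _ Encodable.encode_injective).injective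
  have key : ∀ n, ratCode (Denumerable.ofNat ℚ n) = (Nat.Subtype.ofNat (Set.range (@Encodable.encode ℚ Rat.instEncodable)) n : ℕ) := by
    intro n
    have : Denumerable.ofNat ℚ n = (Encodable.equivRangeEncode ℚ).symm (Nat.Subtype.ofNat (Set.range (@Encodable.encode ℚ Rat.instEncodable)) n) := rfl
    rw [this]
    have h2 : ∀ x : Set.range (@Encodable.encode ℚ Rat.instEncodable), ratCode ((Encodable.equivRangeEncode ℚ).symm x) = x := by
      intro x
      have := (Encodable.equivRangeEncode ℚ).apply_symm_apply x
      conv_rhs => rw [← this]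
      rfl
    exact h2 _
  have h := Nat.Subtype.exists_succ (Nat.Subtype.ofNat (Set.range (@Encodable.encode ℚ Rat.instEncodable)) n)
  rw [← key n] at h
  refine ⟨h, inferInstance, ?_⟩
  rw [key (n+1)]
  simp only [key n, Nat.Subtype.ofNat, Nat.Subtype.succ]
  congr!

theorem mem_range_ratCode (m : ℕ) : m ∈ Set.range ratCode ↔
   0 < m.unpair.2 ∧ ((m.unpair.1 + 1)/2).Coprime m.unpair.2 := by
  have hk : ∀ z : ℤ, (Encodable.encode z + 1)/2 = z.natAbs := by
    intro z
    cases z with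
    | ofNat n => 
      have := int_encode_nonneg n
      simp only [Int.ofNat_eq_natCast, this]; simp; omega
    | negSucc n => rw [int_encode_neg]; simp; omega
  constructor
  · rintro ⟨q, rfl⟩
    rw [ratCode_eq]; simp only [Nat.unpair_pair, hk]
    exact ⟨q.den_pos, q.reduced⟩
  · rintro ⟨h1, h2⟩
    have := Denumerable.encode_ofNat (α := ℤ) m.unpair.1
    have h3 := hk (Denumerable.ofNat ℤ m.unpair.1)
    have h4 : Encodable.encode (Denumerable.ofNat ℤ m.unpair.1) = m.unpair.1 := this
    rw [h4] at h3
    refine ⟨⟨Denumerable.ofNat ℤ m.unpair.1, m.unpair.2, h1.ne', h3 ▸ h2⟩, ?_⟩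
    rw [ratCode_eq]
    simp only [h4, Nat.pair_unpair]

theorem coprime_iff_bdd (n d : ℕ) (hd : 0 < d) : n.Coprime d ↔ ∀ k < d + 1, ¬ (n % k = 0 ∧ d % k = 0 ∧ k ≠ 1) := by
  constructor
  · rintro h k - ⟨h1, h2, h3⟩
    exact h3 (Nat.eq_one_of_dvd_coprimes h (Nat.dvd_of_mod_eq_zero h1) (Nat.dvd_of_mod_eq_zero h2))
  · intro h
    by_contra hc
    refine h (n.gcd d) (Nat.lt_succ_of_le (Nat.gcd_le_right _ hd)) ⟨?_, ?_, hc⟩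
    · exact Nat.mod_eq_zero_of_dvd (Nat.gcd_dvd_left _ _)
    · exact Nat.mod_eq_zero_of_dvd (Nat.gcd_dvd_right _ _)

theorem primrec_inRange : PrimrecPred (fun m => m ∈ Set.range ratCode) := by
  have hu1 : Primrec (fun m : ℕ => m.unpair.1) := Primrec.fst.comp Primrec.unpair
  have hu2 : Primrec (fun m : ℕ => m.unpair.2) := Primrec.snd.comp Primrec.unpair
  have h1 : PrimrecRel (fun (k : ℕ) (y : ℕ) => ¬ (((y.unpair.1+1)/2) % k = 0 ∧ y.unpair.2 % k = 0 ∧ k ≠ 1)) := by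
    refine PrimrecPred.not ?_
    refine PrimrecPred.and ?_ (PrimrecPred.and ?_ (PrimrecPred.not ?_))
    · exact Primrec.eq.comp (Primrec.nat_mod.comp (Primrec.nat_div.comp (Primrec.succ.comp (hu1.comp Primrec.snd)) (Primrec.const 2)) Primrec.fst) (Primrec.const 0)
    · exact Primrec.eq.comp (Primrec.nat_mod.comp (hu2.comp Primrec.snd) Primrec.fst) (Primrec.const 0)
    · exact Primrec.eq.comp Primrec.fst (Primrec.const 1)
  have h2 := PrimrecRel.forall_lt h1
  have h3 : PrimrecPred (fun m : ℕ => 0 < m.unpair.2 ∧ ∀ k < m.unpair.2 + 1, ¬ (((m.unpair.1+1)/2) % k = 0 ∧ m.unpair.2 % k = 0 ∧ k ≠ 1)) := by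
    refine PrimrecPred.and (Primrec.nat_lt.comp (Primrec.const 0) hu2) ?_
    exact h2.comp (Primrec.succ.comp hu2) Primrec.id
  refine h3.of_eq (fun m => ?_)
  rw [mem_range_ratCode]
  constructor
  · rintro ⟨a, b⟩; exact ⟨a, (coprime_iff_bdd _ _ a).2 b⟩
  · rintro ⟨a, b⟩; exact ⟨a, (coprime_iff_bdd _ _ a).1 b⟩

theorem computable_ratCode_ofNat : Computable (fun n => ratCode (Denumerable.ofNat ℚ n)) := by
  classical
  obtain ⟨D, hR⟩ := primrec_inRange
  have hex : ∀ s : ℕ, ∃ m, (fun s m => decide (s + m + 1 ∈ Set.range ratCode)) s m = true := by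
    intro s
    have : (Set.range ratCode).Infinite := Set.infinite_range_of_injective
      (@Encodable.encode_injective ℚ Rat.instEncodable)
    obtain ⟨b, hb, hsb⟩ := this.exists_gt s
    refine ⟨b - s - 1, ?_⟩
    have : s + (b - s - 1) + 1 = b := by omega
    simpa only [this, decide_eq_true_eq] using hb
  have hc : Computable₂ (fun s m => decide (s + m + 1 ∈ Set.range ratCode)) := by
    have h := hR.to_comp.comp ((Primrec.succ.comp (Primrec.nat_add.comp (Primrec.fst (α := ℕ) (β := ℕ)) Primrec.snd)).to_comp)
    refine Computable.of_eq h (fun n => ?_)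
    simp
  have hs := computable_find _ hc hex
  have hrec : Computable (fun n : ℕ => Nat.rec (motive := fun _ => ℕ) (ratCode (Denumerable.ofNat ℚ 0)) (fun _ s => s + Nat.find (hex s) + 1) n) := by
    have h2 : Computable (fun p : ℕ × (ℕ × ℕ) => p.2.2) := (Primrec.snd.comp Primrec.snd).to_comp
    have h3 := hs.comp h2
    have h4 : Computable (fun p : ℕ × (ℕ × ℕ) => p.2.2 + Nat.find (hex p.2.2) + 1) :=
      Computable.succ.comp (Primrec.nat_add.to_comp.comp h2 h3)
    exact Computable.nat_rec (f := fun n : ℕ => n) (h := fun (_ : ℕ) (p : ℕ × ℕ) => p.2 + Nat.find (hex p.2) + 1)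
      Computable.id (Computable.const (ratCode (Denumerable.ofNat ℚ 0))) h4
  refine hrec.of_eq (fun n => ?_)
  induction n with
  | zero => rfl
  | succ n ih =>
    obtain ⟨h, d, e⟩ := ratCode_ofNat_succ n
    rw [e]
    simp only
    have : ∀ (a b : ℕ → Prop) (ha : ∃ n, a n) (hb : ∃ n, b n) (ia : DecidablePred a)
        (ib : DecidablePred b) (_ : ∀ n, a n ↔ b n), Nat.find ha = Nat.find hb := by
      intro a b ha hb ia ib hab
      exact Nat.find_congr' (fun {n} => hab n)
    congr 2
    apply this
    intro m
    rw [ih]; simp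

theorem computable_ratCode : Computable ratCode := by
  have := computable_ratCode_ofNat.comp (Computable.encode (α := ℚ))
  refine this.of_eq (fun q => ?_)
  rw [Denumerable.ofNat_encode]

def ratPos (q : ℚ) : ℕ := q.num.toNat
def ratNeg (q : ℚ) : ℕ := (-q.num).toNat

theorem computable_den : Computable (fun q : ℚ => q.den) := by
  refine (Computable.snd.comp (Computable.unpair.comp computable_ratCode)).of_eq (fun q => ?_)
  rw [ratCode_eq]; simp

theorem computable_ratPos : Computable ratPos := by
  have h1 : Computable (fun q : ℚ => (ratCode q).unpair.1) := (Computable.fst.comp (Computable.unpair.comp computable_ratCode))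
  have h2 : Primrec (fun i : ℕ => if i % 2 = 0 then i / 2 else 0) := by
    refine Primrec.ite (Primrec.eq.comp (Primrec.nat_mod.comp Primrec.id (Primrec.const 2)) (Primrec.const 0)) 
      (Primrec.nat_div.comp Primrec.id (Primrec.const 2)) (Primrec.const 0)
  refine (h2.to_comp.comp h1).of_eq (fun q => ?_)
  rw [ratCode_eq]; simp only [Nat.unpair_pair, ratPos]
  cases q.num with
  | ofNat n => simp only [Int.ofNat_eq_natCast, int_encode_nonneg]; simp
  | negSucc n => rw [int_encode_neg]; simp

theorem computable_ratNeg : Computable ratNeg := by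
  have h1 : Computable (fun q : ℚ => (ratCode q).unpair.1) := (Computable.fst.comp (Computable.unpair.comp computable_ratCode))
  have h2 : Primrec (fun i : ℕ => if i % 2 = 0 then 0 else i / 2 + 1) := by
    refine Primrec.ite (Primrec.eq.comp (Primrec.nat_mod.comp Primrec.id (Primrec.const 2)) (Primrec.const 0)) 
      (Primrec.const 0) (Primrec.succ.comp (Primrec.nat_div.comp Primrec.id (Primrec.const 2)))
  refine (h2.to_comp.comp h1).of_eq (fun q => ?_)
  rw [ratCode_eq]; simp only [Nat.unpair_pair, ratNeg]
  cases q.num with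
  | ofNat n => simp only [Int.ofNat_eq_natCast, int_encode_nonneg]; simp
  | negSucc n => rw [int_encode_neg]; simp; omega

theorem rat_eq_pos_neg (q : ℚ) : q = ((ratPos q : ℚ) - ratNeg q) / q.den := by
  conv_lhs => rw [← Rat.num_div_den q]
  congr 1
  have : q.num = (ratPos q : ℤ) - ratNeg q := by unfold ratPos ratNeg; omega
  rw [this]; push_cast; rfl

theorem computable_of_graph_aux {α σ : Type*} [Primcodable α] [Primcodable σ] [DecidableEq σ]
    (e : ℕ → σ) (he : Computable e) (hs : Function.Surjective e) (g : α → σ)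
    (h : Computable (fun p : α × σ => decide (g p.1 = p.2))) : Computable g := by
  have hc : Computable₂ (fun (a : α) (n : ℕ) => decide (g a = e n)) := by
    have h1 : Computable (fun p : α × ℕ => (p.1, e p.2)) :=
      Computable.fst.pair (he.comp Computable.snd)
    exact h.comp h1
  have hex : ∀ a : α, ∃ n, decide (g a = e n) = true := by
    intro a
    obtain ⟨n, hn⟩ := hs (g a)
    exact ⟨n, decide_eq_true hn.symm⟩
  have h2 := he.comp (computable_find _ hc hex)
  refine h2.of_eq (fun a => ?_)
  have := Nat.find_spec (hex a)
  exact (of_decide_eq_true this).symm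

theorem computable_of_graph {α : Type*} [Primcodable α] (g : α → ℚ)
    (h : Computable (fun p : α × ℚ => decide (g p.1 = p.2))) : Computable g :=
  computable_of_graph_aux (Denumerable.ofNat ℚ) (Computable.ofNat ℚ)
    (fun q => ⟨_, Denumerable.ofNat_encode q⟩) g h

theorem computable_nat_decEq {α : Type*} [Primcodable α] {f g : α → ℕ} (hf : Computable f)
    (hg : Computable g) : Computable (fun a => decide (f a = g a)) := by
  obtain ⟨_, h⟩ := (Primrec.eq (α := ℕ))
  refine (h.to_comp.comp (hf.pair hg)).of_eq (fun a => ?_)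
  simp

theorem computable_nat_decLe {α : Type*} [Primcodable α] {f g : α → ℕ} (hf : Computable f)
    (hg : Computable g) : Computable (fun a => decide (f a ≤ g a)) := by
  obtain ⟨_, h⟩ := Primrec.nat_le
  refine (h.to_comp.comp (hf.pair hg)).of_eq (fun a => ?_)
  simp

section ops
variable {α : Type*} [Primcodable α]

theorem cAdd {f g : α → ℕ} (hf : Computable f) (hg : Computable g) :
    Computable (fun a => f a + g a) := Primrec.nat_add.to_comp.comp hf hg

theorem cMul {f g : α → ℕ} (hf : Computable f) (hg : Computable g) :
    Computable (fun a => f a * g a) := Primrec.nat_mul.to_comp.comp hf hg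

theorem rat_le_iff_nat (x y : ℚ) : x ≤ y ↔
    ratPos x * y.den + ratNeg y * x.den ≤ ratPos y * x.den + ratNeg x * y.den := by
  have hx := rat_eq_pos_neg x
  have hy := rat_eq_pos_neg y
  have dx : (0:ℚ) < x.den := by exact_mod_cast x.den_pos
  have dy : (0:ℚ) < y.den := by exact_mod_cast y.den_pos
  have : x ≤ y ↔ ((ratPos x : ℚ) - ratNeg x) / x.den ≤ ((ratPos y : ℚ) - ratNeg y) / y.den := by
    rw [← hx, ← hy]
  rw [this, div_le_div_iff₀ dx dy, ← Nat.cast_le (α := ℚ)]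
  push_cast
  constructor <;> intro h <;> linarith

theorem rLe {f g : α → ℚ} (hf : Computable f) (hg : Computable g) :
    Computable (fun a => decide (f a ≤ g a)) := by
  have h := computable_nat_decLe
    (cAdd (cMul (computable_ratPos.comp hf) (computable_den.comp hg))
      (cMul (computable_ratNeg.comp hg) (computable_den.comp hf)))
    (cAdd (cMul (computable_ratPos.comp hg) (computable_den.comp hf))
      (cMul (computable_ratNeg.comp hf) (computable_den.comp hg)))
  refine h.of_eq (fun a => ?_)
  simp only [rat_le_iff_nat]

theorem bAnd {f g : α → Bool} (hf : Computable f) (hg : Computable g) :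
    Computable (fun a => f a && g a) := Primrec.and.to_comp.comp hf hg

theorem bOr {f g : α → Bool} (hf : Computable f) (hg : Computable g) :
    Computable (fun a => f a || g a) := Primrec.or.to_comp.comp hf hg

theorem bNot {f : α → Bool} (hf : Computable f) :
    Computable (fun a => !(f a)) := Primrec.not.to_comp.comp hf

theorem rLt {f g : α → ℚ} (hf : Computable f) (hg : Computable g) :
    Computable (fun a => decide (f a < g a)) := by
  refine (bNot (rLe hg hf)).of_eq (fun a => ?_)
  simp [← not_le]

theorem rEq {f g : α → ℚ} (hf : Computable f) (hg : Computable g) :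
    Computable (fun a => decide (f a = g a)) := by
  refine (bAnd (rLe hf hg) (rLe hg hf)).of_eq (fun a => ?_)
  simp [le_antisymm_iff]

theorem graph_add (x y z : ℚ) : (ratPos x * y.den + ratPos y * x.den) * z.den + ratNeg z * (x.den * y.den) =
    (ratNeg x * y.den + ratNeg y * x.den) * z.den + ratPos z * (x.den * y.den) ↔ x + y = z := by
  have hx := rat_eq_pos_neg x
  have hy := rat_eq_pos_neg y
  have hz := rat_eq_pos_neg z
  have dx : (x.den : ℚ) ≠ 0 := by exact_mod_cast x.den_nz
  have dy : (y.den : ℚ) ≠ 0 := by exact_mod_cast y.den_nz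
  have dz : (z.den : ℚ) ≠ 0 := by exact_mod_cast z.den_nz
  generalize ratPos x = p1 at *
  generalize ratNeg x = n1 at *
  generalize ratPos y = p2 at *
  generalize ratNeg y = n2 at *
  generalize ratPos z = p3 at *
  generalize ratNeg z = n3 at *
  generalize x.den = d1 at *
  generalize y.den = d2 at *
  generalize z.den = d3 at *
  rw [hx, hy, hz, div_add_div _ _ dx dy, div_eq_div_iff (mul_ne_zero dx dy) dz, ← Nat.cast_inj (R := ℚ)]
  push_cast
  constructor <;> intro h <;> linarith

theorem graph_mul (x y z : ℚ) : (ratPos x * ratPos y + ratNeg x * ratNeg y) * z.den + ratNeg z * (x.den * y.den) =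
    (ratNeg x * ratPos y + ratPos x * ratNeg y) * z.den + ratPos z * (x.den * y.den) ↔ x * y = z := by
  have hx := rat_eq_pos_neg x
  have hy := rat_eq_pos_neg y
  have hz := rat_eq_pos_neg z
  have dx : (x.den : ℚ) ≠ 0 := by exact_mod_cast x.den_nz
  have dy : (y.den : ℚ) ≠ 0 := by exact_mod_cast y.den_nz
  have dz : (z.den : ℚ) ≠ 0 := by exact_mod_cast z.den_nz
  generalize ratPos x = p1 at *
  generalize ratNeg x = n1 at *
  generalize ratPos y = p2 at *
  generalize ratNeg y = n2 at *
  generalize ratPos z = p3 at *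
  generalize ratNeg z = n3 at *
  generalize x.den = d1 at *
  generalize y.den = d2 at *
  generalize z.den = d3 at *
  rw [hx, hy, hz, div_mul_div_comm, div_eq_div_iff (mul_ne_zero dx dy) dz, ← Nat.cast_inj (R := ℚ)]
  push_cast
  constructor <;> intro h <;> linarith

theorem rAdd {f g : α → ℚ} (hf : Computable f) (hg : Computable g) :
    Computable (fun a => f a + g a) := by
  have px : Computable (fun p : α × ℚ => f p.1) := hf.comp Computable.fst
  have py : Computable (fun p : α × ℚ => g p.1) := hg.comp Computable.fst
  have pz : Computable (fun p : α × ℚ => p.2) := Computable.snd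
  have xP := computable_ratPos.comp px
  have xN := computable_ratNeg.comp px
  have xD := computable_den.comp px
  have yP := computable_ratPos.comp py
  have yN := computable_ratNeg.comp py
  have yD := computable_den.comp py
  have zP := computable_ratPos.comp pz
  have zN := computable_ratNeg.comp pz
  have zD := computable_den.comp pz
  refine computable_of_graph _ ((computable_nat_decEq
      (cAdd (cMul (cAdd (cMul xP yD) (cMul yP xD)) zD) (cMul zN (cMul xD yD)))
      (cAdd (cMul (cAdd (cMul xN yD) (cMul yN xD)) zD) (cMul zP (cMul xD yD)))).of_eq (fun p => ?_))
  exact decide_eq_decide.2 (graph_add (f p.1) (g p.1) p.2)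

theorem rMul {f g : α → ℚ} (hf : Computable f) (hg : Computable g) :
    Computable (fun a => f a * g a) := by
  have px : Computable (fun p : α × ℚ => f p.1) := hf.comp Computable.fst
  have py : Computable (fun p : α × ℚ => g p.1) := hg.comp Computable.fst
  have pz : Computable (fun p : α × ℚ => p.2) := Computable.snd
  have xP := computable_ratPos.comp px
  have xN := computable_ratNeg.comp px
  have xD := computable_den.comp px
  have yP := computable_ratPos.comp py
  have yN := computable_ratNeg.comp py
  have yD := computable_den.comp py
  have zP := computable_ratPos.comp pz
  have zN := computable_ratNeg.comp pz
  have zD := computable_den.comp pz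
  refine computable_of_graph _ ((computable_nat_decEq
      (cAdd (cMul (cAdd (cMul xP yP) (cMul xN yN)) zD) (cMul zN (cMul xD yD)))
      (cAdd (cMul (cAdd (cMul xN yP) (cMul xP yN)) zD) (cMul zP (cMul xD yD)))).of_eq (fun p => ?_))
  exact decide_eq_decide.2 (graph_mul (f p.1) (g p.1) p.2)

theorem rSub {f g : α → ℚ} (hf : Computable f) (hg : Computable g) :
    Computable (fun a => f a - g a) := by
  refine (rAdd hf (rMul (Computable.const (-1)) hg)).of_eq (fun a => ?_)
  ring

theorem rInv {f : α → ℚ} (hf : Computable f) : Computable (fun a => (f a)⁻¹) := by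
  have key : Computable (fun p : ℚ => p⁻¹) := by
    apply computable_of_graph
    have px : Computable (fun p : ℚ × ℚ => p.1) := Computable.fst
    have py : Computable (fun p : ℚ × ℚ => p.2) := Computable.snd
    refine (bOr (rEq (rMul px py) (Computable.const 1))
      (bAnd (rEq px (Computable.const 0)) (rEq py (Computable.const 0)))).of_eq (fun p => ?_)
    obtain ⟨x, y⟩ := p
    rw [Bool.eq_iff_iff]
    simp only [Bool.or_eq_true, Bool.and_eq_true, decide_eq_true_eq]
    constructor
    · rintro (h | ⟨h1, h2⟩)
      · exact inv_eq_of_mul_eq_one_right h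
      · rw [h1, h2, inv_zero]
    · intro h
      by_cases hx : x = 0
      · right; subst hx; simp at h; exact ⟨rfl, h.symm⟩
      · left; rw [← h]; exact mul_inv_cancel₀ hx
  exact key.comp hf

theorem rDiv {f g : α → ℚ} (hf : Computable f) (hg : Computable g) :
    Computable (fun a => f a / g a) := by
  refine (rMul hf (rInv hg)).of_eq (fun a => ?_)
  rw [div_eq_mul_inv]

theorem cIte {σ : Type*} [Primcodable σ] {c : α → Prop} [DecidablePred c] {f g : α → σ}
    (hc : Computable (fun a => decide (c a))) (hf : Computable f) (hg : Computable g) :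
    Computable (fun a => if c a then f a else g a) := by
  refine (Computable.cond hc hf hg).of_eq (fun a => ?_)
  by_cases h : c a <;> simp [h]

theorem rMax {f g : α → ℚ} (hf : Computable f) (hg : Computable g) :
    Computable (fun a => max (f a) (g a)) := by
  refine (cIte (rLe hf hg) hg hf).of_eq (fun a => ?_)
  rw [max_def]

theorem rMin {f g : α → ℚ} (hf : Computable f) (hg : Computable g) :
    Computable (fun a => min (f a) (g a)) := by
  refine (cIte (rLe hf hg) hf hg).of_eq (fun a => ?_)
  rw [min_def]

/-- bounded universal quantifier -/
theorem bForall {f : α → ℕ} {p : α → ℕ → Bool} (hf : Computable f) (hp : Computable₂ p) :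
    Computable (fun a => decide (∀ i < f a, p a i = true)) := by
  have h : Computable (fun a => Nat.rec (motive := fun _ => Bool) true
      (fun i b => b && p a i) (f a)) := by
    have h2 : Computable (fun q : α × (ℕ × Bool) => q.2.2) := Computable.snd.comp Computable.snd
    have h1 : Computable (fun q : α × (ℕ × Bool) => q.2.1) := Computable.fst.comp Computable.snd
    have h0 : Computable (fun q : α × (ℕ × Bool) => q.1) := Computable.fst
    have h4 : Computable (fun q : α × (ℕ × Bool) => q.2.2 && p q.1 q.2.1) :=
      bAnd h2 (hp.comp h0 h1)
    exact Computable.nat_rec (h := fun (a : α) (q : ℕ × Bool) => q.2 && p a q.1) hf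
      (Computable.const true) h4
  refine h.of_eq (fun a => ?_)
  induction f a with
  | zero => simp
  | succ n ih =>
    simp only [ih]
    rw [Bool.eq_iff_iff]
    simp only [Bool.and_eq_true, decide_eq_true_eq]
    constructor
    · rintro ⟨h1, h2⟩ i hi
      rcases Nat.lt_succ_iff_lt_or_eq.1 hi with h | h
      · exact h1 i h
      · exact h ▸ h2
    · intro h
      exact ⟨fun i hi => h i (by omega), h n (by omega)⟩

end ops

/-- decidable predicates, Boolean form -/
def CPred {α : Type*} [Primcodable α] (p : α → Prop) : Prop :=
  ∃ b : α → Bool, Computable b ∧ ∀ a, b a = true ↔ p a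

namespace CPred
variable {α : Type*} [Primcodable α] {p q : α → Prop}

theorem and (hp : CPred p) (hq : CPred q) : CPred (fun a => p a ∧ q a) := by
  obtain ⟨b, hb, h⟩ := hp
  obtain ⟨b', hb', h'⟩ := hq
  exact ⟨_, bAnd hb hb', fun a => by simp [h, h']⟩

theorem or (hp : CPred p) (hq : CPred q) : CPred (fun a => p a ∨ q a) := by
  obtain ⟨b, hb, h⟩ := hp
  obtain ⟨b', hb', h'⟩ := hq
  exact ⟨_, bOr hb hb', fun a => by simp [h, h']⟩

theorem not (hp : CPred p) : CPred (fun a => ¬ p a) := by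
  obtain ⟨b, hb, h⟩ := hp
  exact ⟨_, bNot hb, fun a => by simp [← h]⟩

theorem imp (hp : CPred p) (hq : CPred q) : CPred (fun a => p a → q a) := by
  obtain ⟨b, hb, h⟩ := hp.not.or hq
  exact ⟨b, hb, fun a => by rw [h]; tauto⟩

theorem le {f g : α → ℚ} (hf : Computable f) (hg : Computable g) : CPred (fun a => f a ≤ g a) :=
  ⟨_, rLe hf hg, fun a => by simp⟩

theorem lt {f g : α → ℚ} (hf : Computable f) (hg : Computable g) : CPred (fun a => f a < g a) :=
  ⟨_, rLt hf hg, fun a => by simp⟩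

theorem eq {f g : α → ℚ} (hf : Computable f) (hg : Computable g) : CPred (fun a => f a = g a) :=
  ⟨_, rEq hf hg, fun a => by simp⟩

theorem nle {f g : α → ℕ} (hf : Computable f) (hg : Computable g) : CPred (fun a => f a ≤ g a) :=
  ⟨_, computable_nat_decLe hf hg, fun a => by simp⟩

theorem neq {f g : α → ℕ} (hf : Computable f) (hg : Computable g) : CPred (fun a => f a = g a) :=
  ⟨_, computable_nat_decEq hf hg, fun a => by simp⟩

theorem ball {f : α → ℕ} {r : α → ℕ → Prop} (hf : Computable f)
    (hr : CPred (fun y : α × ℕ => r y.1 y.2)) : CPred (fun a => ∀ i < f a, r a i) := by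
  obtain ⟨b, hb, h⟩ := hr
  exact ⟨_, bForall (p := fun a i => b (a, i)) hf hb, fun a => by simp [h]⟩

theorem ite {σ : Type*} [Primcodable σ] (hp : CPred p) [DecidablePred p] {f g : α → σ}
    (hf : Computable f) (hg : Computable g) : Computable (fun a => if p a then f a else g a) := by
  obtain ⟨b, hb, h⟩ := hp
  refine (Computable.cond hb hf hg).of_eq (fun a => ?_)
  by_cases hpa : p a
  · simp [(h a).2 hpa, hpa]
  · have : b a = false := by
      rw [← Bool.not_eq_true, h]; exact hpa
    simp [this, hpa]

end CPred

theorem cIter {α σ : Type*} [Primcodable α] [Primcodable σ] {n : α → ℕ} {x : α → σ}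
    {h : α → σ → σ} (hn : Computable n) (hx : Computable x)
    (hh : Computable (fun y : α × σ => h y.1 y.2)) :
    Computable (fun a => (h a)^[n a] (x a)) := by
  have h4 : Computable (fun q : α × (ℕ × σ) => h q.1 q.2.2) :=
    hh.comp (Computable.fst.pair (Computable.snd.comp Computable.snd))
  have := Computable.nat_rec (h := fun (a : α) (q : ℕ × σ) => h a q.2) hn hx h4
  refine this.of_eq (fun a => ?_)
  induction n a with
  | zero => rfl
  | succ n ih => rw [Function.iterate_succ_apply', ← ih]

/-- pair dynamics : a point and the affine continuation of a companion point -/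
def stepPair (a1 b1 a2 b2 c : ℚ) (P : ℚ × ℚ) : ℚ × ℚ :=
  (pam2 a1 b1 a2 b2 c P.1, if P.1 < c then a1 * P.2 + b1 else a2 * P.2 + b2)

/-- half-open segment from `x` (included) towards `l` -/
def Seg (x l y : ℚ) : Prop := y = x ∨ (x ≤ y ∧ y < l) ∨ (l < y ∧ y ≤ x)

def hitP (a1 b1 a2 b2 c x0 u v : ℚ) (k : ℕ) : Prop :=
  u ≤ (pam2 a1 b1 a2 b2 c)^[k] x0 ∧ (pam2 a1 b1 a2 b2 c)^[k] x0 < v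

/-- local condition in the first certificate -/
def goodPair (c u v : ℚ) (P : ℚ × ℚ) : Prop :=
  (P.1 < c → 0 ≤ P.2 ∧ P.2 ≤ c) ∧ (¬ P.1 < c → c ≤ P.2 ∧ P.2 ≤ 1) ∧
    ((P.1 < u ∧ P.2 ≤ u) ∨ (v ≤ P.1 ∧ v ≤ P.2))

def cert1 (a1 b1 a2 b2 c x0 u v : ℚ) (n p : ℕ) (L : ℚ) : Prop :=
  1 ≤ p ∧ (∀ j < n, ¬ hitP a1 b1 a2 b2 c x0 u v j) ∧
  (∀ i < p, goodPair c u v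
    ((stepPair a1 b1 a2 b2 c)^[i] ((pam2 a1 b1 a2 b2 c)^[n] x0, L))) ∧
  ((stepPair a1 b1 a2 b2 c)^[p] ((pam2 a1 b1 a2 b2 c)^[n] x0, L)).2 = L ∧
  Seg ((pam2 a1 b1 a2 b2 c)^[n] x0) L ((pam2 a1 b1 a2 b2 c)^[n + p] x0)

/-- pull back an interval along a branch chosen by the last binary digit -/
def jstep (a1 b1 a2 b2 c : ℚ) (S : ℕ × (ℚ × ℚ)) : ℕ × (ℚ × ℚ) :=
  (S.1 / 2, if S.1 % 2 = 0 then (max 0 ((S.2.1 - b1) / a1), min c ((S.2.2 - b1) / a1))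
    else (max c ((S.2.1 - b2) / a2), min 1 ((S.2.2 - b2) / a2)))

def cert2 (a1 b1 a2 b2 c x0 u v : ℚ) (m : ℕ) : Prop :=
  0 < a1 ∧ 0 < a2 ∧ (∀ j < m, ¬ hitP a1 b1 a2 b2 c x0 u v j) ∧
  ∀ w < 2 ^ m, ((jstep a1 b1 a2 b2 c)^[m] (w, (u, v))).2.2 ≤
    ((jstep a1 b1 a2 b2 c)^[m] (w, (u, v))).2.1

def inUnit (x : ℚ) : Prop := 0 ≤ x ∧ x < 1

/-- witnesses that the promise is violated -/
def badP (a1 b1 a2 b2 c x0 u v x y : ℚ) : Prop :=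
  ¬ 0 < c ∨ ¬ c < 1 ∨ ¬ inUnit x0 ∨ ¬ 0 ≤ u ∨ ¬ u < v ∨ ¬ v ≤ 1 ∨
  (inUnit x ∧ ¬ inUnit (pam2 a1 b1 a2 b2 c x)) ∨
  (inUnit x ∧ inUnit y ∧ ¬ x = y ∧ pam2 a1 b1 a2 b2 c x = pam2 a1 b1 a2 b2 c y)

def stopP (a1 b1 a2 b2 c x0 u v : ℚ) (k : ℕ) : Prop :=
  hitP a1 b1 a2 b2 c x0 u v k ∨
  cert1 a1 b1 a2 b2 c x0 u v k.unpair.1 k.unpair.2.unpair.1 (Denumerable.ofNat ℚ k.unpair.2.unpair.2) ∨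
  cert2 a1 b1 a2 b2 c x0 u v k ∨
  badP a1 b1 a2 b2 c x0 u v (Denumerable.ofNat ℚ k.unpair.1) (Denumerable.ofNat ℚ k.unpair.2)

section comp
variable {α : Type*} [Primcodable α]

theorem cPam {a1 b1 a2 b2 c x : α → ℚ} (h1 : Computable a1) (h2 : Computable b1)
    (h3 : Computable a2) (h4 : Computable b2) (h5 : Computable c) (hx : Computable x) :
    Computable (fun a => pam2 (a1 a) (b1 a) (a2 a) (b2 a) (c a) (x a)) := by
  have k0 : Computable (fun _ : α => (0:ℚ)) := Computable.const 0
  have k1 : Computable (fun _ : α => (1:ℚ)) := Computable.const 1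
  exact ((CPred.le k0 hx).and (CPred.lt hx h5)).ite (rAdd (rMul h1 hx) h2)
    (((CPred.le h5 hx).and (CPred.lt hx k1)).ite (rAdd (rMul h3 hx) h4) k0)

theorem cPamIter {a1 b1 a2 b2 c x : α → ℚ} {n : α → ℕ} (h1 : Computable a1) (h2 : Computable b1)
    (h3 : Computable a2) (h4 : Computable b2) (h5 : Computable c) (hx : Computable x)
    (hn : Computable n) :
    Computable (fun a => (pam2 (a1 a) (b1 a) (a2 a) (b2 a) (c a))^[n a] (x a)) := by
  have F : Computable (fun y : α × ℚ => y.1) := Computable.fst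
  exact cIter (h := fun a => pam2 (a1 a) (b1 a) (a2 a) (b2 a) (c a)) hn hx
    (cPam (h1.comp F) (h2.comp F) (h3.comp F) (h4.comp F) (h5.comp F) Computable.snd)

theorem cHit {a1 b1 a2 b2 c x u v : α → ℚ} {n : α → ℕ} (h1 : Computable a1) (h2 : Computable b1)
    (h3 : Computable a2) (h4 : Computable b2) (h5 : Computable c) (hx : Computable x)
    (hu : Computable u) (hv : Computable v) (hn : Computable n) :
    CPred (fun a => hitP (a1 a) (b1 a) (a2 a) (b2 a) (c a) (x a) (u a) (v a) (n a)) := by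
  have := cPamIter h1 h2 h3 h4 h5 hx hn
  exact (CPred.le hu this).and (CPred.lt this hv)

theorem cStepPair {a1 b1 a2 b2 c x l : α → ℚ} {n : α → ℕ} (h1 : Computable a1) (h2 : Computable b1)
    (h3 : Computable a2) (h4 : Computable b2) (h5 : Computable c) (hx : Computable x)
    (hl : Computable l) (hn : Computable n) :
    Computable (fun a => (stepPair (a1 a) (b1 a) (a2 a) (b2 a) (c a))^[n a] (x a, l a)) := by
  have F : Computable (fun y : α × (ℚ × ℚ) => y.1) := Computable.fst
  have G : Computable (fun y : α × (ℚ × ℚ) => y.2.1) := Computable.fst.comp Computable.snd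
  have H : Computable (fun y : α × (ℚ × ℚ) => y.2.2) := Computable.snd.comp Computable.snd
  refine cIter (h := fun a => stepPair (a1 a) (b1 a) (a2 a) (b2 a) (c a)) hn (hx.pair hl) ?_
  exact (cPam (h1.comp F) (h2.comp F) (h3.comp F) (h4.comp F) (h5.comp F) G).pair
    ((CPred.lt G (h5.comp F)).ite (rAdd (rMul (h1.comp F) H) (h2.comp F))
      (rAdd (rMul (h3.comp F) H) (h4.comp F)))

theorem cJstep {a1 b1 a2 b2 c u v : α → ℚ} {n w : α → ℕ} (h1 : Computable a1) (h2 : Computable b1)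
    (h3 : Computable a2) (h4 : Computable b2) (h5 : Computable c) (hu : Computable u)
    (hv : Computable v) (hn : Computable n) (hw : Computable w) :
    Computable (fun a => (jstep (a1 a) (b1 a) (a2 a) (b2 a) (c a))^[n a] (w a, (u a, v a))) := by
  have F : Computable (fun y : α × (ℕ × (ℚ × ℚ)) => y.1) := Computable.fst
  have G : Computable (fun y : α × (ℕ × (ℚ × ℚ)) => y.2.1) := Computable.fst.comp Computable.snd
  have H : Computable (fun y : α × (ℕ × (ℚ × ℚ)) => y.2.2) := Computable.snd.comp Computable.snd
  have H1 : Computable (fun y : α × (ℕ × (ℚ × ℚ)) => y.2.2.1) := Computable.fst.comp H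
  have H2 : Computable (fun y : α × (ℕ × (ℚ × ℚ)) => y.2.2.2) := Computable.snd.comp H
  have k0 : Computable (fun _ : α × (ℕ × (ℚ × ℚ)) => (0:ℚ)) := Computable.const 0
  have k1 : Computable (fun _ : α × (ℕ × (ℚ × ℚ)) => (1:ℚ)) := Computable.const 1
  have n2 : Computable (fun _ : α × (ℕ × (ℚ × ℚ)) => (2:ℕ)) := Computable.const 2
  have n0 : Computable (fun _ : α × (ℕ × (ℚ × ℚ)) => (0:ℕ)) := Computable.const 0
  refine cIter (h := fun a => jstep (a1 a) (b1 a) (a2 a) (b2 a) (c a)) hn (hw.pair (hu.pair hv)) ?_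
  have d : Computable (fun y : α × (ℕ × (ℚ × ℚ)) => y.2.1 / 2) :=
    Primrec.nat_div.to_comp.comp G n2
  have r : Computable (fun y : α × (ℕ × (ℚ × ℚ)) => y.2.1 % 2) :=
    Primrec.nat_mod.to_comp.comp G n2
  exact d.pair ((CPred.neq r n0).ite
    ((rMax k0 (rDiv (rSub H1 (h2.comp F)) (h1.comp F))).pair
      (rMin (h5.comp F) (rDiv (rSub H2 (h2.comp F)) (h1.comp F))))
    ((rMax (h5.comp F) (rDiv (rSub H1 (h4.comp F)) (h3.comp F))).pair
      (rMin k1 (rDiv (rSub H2 (h4.comp F)) (h3.comp F)))))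

theorem cPow2 {n : α → ℕ} (hn : Computable n) : Computable (fun a => 2 ^ n a) := by
  have h := cIter (h := fun _ (s : ℕ) => 2 * s) hn (Computable.const (1:ℕ))
    (cMul (Computable.const 2) Computable.snd)
  refine h.of_eq (fun a => ?_)
  induction n a with
  | zero => rfl
  | succ n ih => rw [Function.iterate_succ_apply', ih, pow_succ, mul_comm]

theorem cUnit {x : α → ℚ} (hx : Computable x) : CPred (fun a => inUnit (x a)) :=
  (CPred.le (Computable.const 0) hx).and (CPred.lt hx (Computable.const 1))

theorem cStop {a1 b1 a2 b2 c x0 u v : α → ℚ} {k : α → ℕ} (h1 : Computable a1) (h2 : Computable b1)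
    (h3 : Computable a2) (h4 : Computable b2) (h5 : Computable c) (hx : Computable x0)
    (hu : Computable u) (hv : Computable v) (hk : Computable k) :
    CPred (fun a => stopP (a1 a) (b1 a) (a2 a) (b2 a) (c a) (x0 a) (u a) (v a) (k a)) := by
  have k0 : Computable (fun _ : α => (0:ℚ)) := Computable.const 0
  have k1 : Computable (fun _ : α => (1:ℚ)) := Computable.const 1
  have l : Computable (fun a => (k a).unpair.1) := Computable.fst.comp (Computable.unpair.comp hk)
  have r : Computable (fun a => (k a).unpair.2) := Computable.snd.comp (Computable.unpair.comp hk)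
  have rl : Computable (fun a => (k a).unpair.2.unpair.1) :=
    Computable.fst.comp (Computable.unpair.comp r)
  have rr : Computable (fun a => (k a).unpair.2.unpair.2) :=
    Computable.snd.comp (Computable.unpair.comp r)
  have x := (Computable.ofNat ℚ).comp l
  have y := (Computable.ofNat ℚ).comp r
  have L := (Computable.ofNat ℚ).comp rr
  have F : Computable (fun y : α × ℕ => y.1) := Computable.fst
  have S : Computable (fun y : α × ℕ => y.2) := Computable.snd
  refine CPred.or (cHit h1 h2 h3 h4 h5 hx hu hv hk) (CPred.or ?_ (CPred.or ?_ ?_))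
  · have xn := cPamIter h1 h2 h3 h4 h5 hx l
    have xnp := cPamIter h1 h2 h3 h4 h5 hx (cAdd l rl)
    have Pp := cStepPair h1 h2 h3 h4 h5 xn L rl
    have Pi := cStepPair (h1.comp F) (h2.comp F) (h3.comp F) (h4.comp F) (h5.comp F) (xn.comp F)
      (L.comp F) S
    have A := Computable.fst.comp Pi
    have B := Computable.snd.comp Pi
    have C := h5.comp F
    have U := hu.comp F
    have V := hv.comp F
    have K0 := k0.comp F
    have K1 := k1.comp F
    refine (CPred.nle (Computable.const 1) rl).and (CPred.and ?_ (CPred.and ?_ (CPred.and ?_ ?_)))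
    · exact CPred.ball l (CPred.not (cHit (h1.comp F) (h2.comp F) (h3.comp F) (h4.comp F)
        (h5.comp F) (hx.comp F) (hu.comp F) (hv.comp F) S))
    · refine CPred.ball rl ?_
      exact (CPred.imp (CPred.lt A C) ((CPred.le K0 B).and (CPred.le B C))).and
        ((CPred.imp (CPred.lt A C).not ((CPred.le C B).and (CPred.le B K1))).and
          (((CPred.lt A U).and (CPred.le B U)).or ((CPred.le V A).and (CPred.le V B))))
    · exact CPred.eq (Computable.snd.comp Pp) L
    · exact (CPred.eq xnp xn).or (((CPred.le xn xnp).and (CPred.lt xnp L)).or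
        ((CPred.lt L xnp).and (CPred.le xnp xn)))
  · have J := cJstep (h1.comp F) (h2.comp F) (h3.comp F) (h4.comp F) (h5.comp F) (hu.comp F)
      (hv.comp F) (hk.comp F) S
    refine (CPred.lt k0 h1).and ((CPred.lt k0 h3).and (CPred.and ?_ ?_))
    · exact CPred.ball hk (CPred.not (cHit (h1.comp F) (h2.comp F) (h3.comp F) (h4.comp F)
        (h5.comp F) (hx.comp F) (hu.comp F) (hv.comp F) S))
    · refine CPred.ball (cPow2 hk) ?_
      exact CPred.le (Computable.snd.comp (Computable.snd.comp J))
        (Computable.fst.comp (Computable.snd.comp J))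
  · have fx := cPam h1 h2 h3 h4 h5 x
    have fy := cPam h1 h2 h3 h4 h5 y
    exact (CPred.lt k0 h5).not.or ((CPred.lt h5 k1).not.or ((cUnit hx).not.or
      ((CPred.le k0 hu).not.or ((CPred.lt hu hv).not.or ((CPred.le hv k1).not.or
      (((cUnit x).and (cUnit fx).not).or
      ((cUnit x).and ((cUnit y).and ((CPred.eq x y).not.and (CPred.eq fx fy))))))))))
end comp

/-- the promise -/
structure Prom (a1 b1 a2 b2 c : ℚ) : Prop where
  c0 : 0 < c
  c1 : c < 1
  maps : ∀ x ∈ Set.Ico (0 : ℚ) 1, pam2 a1 b1 a2 b2 c x ∈ Set.Ico (0 : ℚ) 1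
  inj : Set.InjOn (pam2 a1 b1 a2 b2 c) (Set.Ico (0 : ℚ) 1)

section basics
variable {a1 b1 a2 b2 c x0 u v : ℚ}

theorem pamA {x : ℚ} (h0 : 0 ≤ x) (h1 : x < c) : pam2 a1 b1 a2 b2 c x = a1 * x + b1 := by
  simp [pam2, h0, h1]

theorem pamB {x : ℚ} (h0 : c ≤ x) (h1 : x < 1) : pam2 a1 b1 a2 b2 c x = a2 * x + b2 := by
  simp [pam2, h0, h1, not_lt.2 h0]

theorem Prom.a1_ne (P : Prom a1 b1 a2 b2 c) : a1 ≠ 0 := by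
  intro h
  have h0 := P.c0
  have h1 := P.c1
  have := P.inj (x₁ := 0) (x₂ := c / 2) ⟨le_refl _, by linarith⟩ ⟨by linarith, by linarith⟩
    (by rw [pamA (le_refl _) h0, pamA (by linarith) (by linarith), h]; ring)
  linarith

theorem Prom.a2_ne (P : Prom a1 b1 a2 b2 c) : a2 ≠ 0 := by
  intro h
  have h0 := P.c0
  have h1 := P.c1
  have := P.inj (x₁ := c) (x₂ := (c + 1) / 2) ⟨h0.le, by linarith⟩ ⟨by linarith, by linarith⟩
    (by rw [pamB (le_refl _) h1, pamB (by linarith) (by linarith), h]; ring)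
  linarith

theorem Prom.iter_mem (P : Prom a1 b1 a2 b2 c) (hx : x0 ∈ Set.Ico (0 : ℚ) 1) (n : ℕ) :
    (pam2 a1 b1 a2 b2 c)^[n] x0 ∈ Set.Ico (0 : ℚ) 1 := by
  induction n with
  | zero => exact hx
  | succ n ih => rw [Function.iterate_succ_apply']; exact P.maps _ ih

theorem Seg.trans {x L z w : ℚ} (h1 : Seg x L z) (h2 : Seg z L w) : Seg x L w := by
  unfold Seg at *
  grind

theorem Seg.affine {x l y a b : ℚ} (ha : a ≠ 0) (h : Seg x l y) :
    Seg (a * x + b) (a * l + b) (a * y + b) := by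
  rcases h with h | ⟨h1, h2⟩ | ⟨h1, h2⟩
  · left; rw [h]
  · rcases ha.lt_or_gt with h | h
    · right; right
      constructor <;> nlinarith
    · right; left
      constructor <;> nlinarith
  · rcases ha.lt_or_gt with h | h
    · right; left
      constructor <;> nlinarith
    · right; right
      constructor <;> nlinarith

theorem goodPair_step (P : Prom a1 b1 a2 b2 c) {Q : ℚ × ℚ} {y : ℚ} (hQ : Q.1 ∈ Set.Ico (0 : ℚ) 1)
    (hg : goodPair c u v Q) (hs : Seg Q.1 Q.2 y) :
    y ∈ Set.Ico (0 : ℚ) 1 ∧ ¬ (u ≤ y ∧ y < v) ∧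
    Seg (stepPair a1 b1 a2 b2 c Q).1 (stepPair a1 b1 a2 b2 c Q).2 (pam2 a1 b1 a2 b2 c y) := by
  obtain ⟨x, l⟩ := Q
  obtain ⟨g1, g2, g3⟩ := hg
  have hc1 := P.c1
  have hc0 := P.c0
  simp only at *
  obtain ⟨hx0, hx1⟩ := hQ
  have hU : ¬ (u ≤ y ∧ y < v) := by
    unfold Seg at hs
    grind
  by_cases hx : x < c
  · obtain ⟨l0, l1⟩ := g1 hx
    have hy : 0 ≤ y ∧ y < c := by unfold Seg at hs; grind
    refine ⟨⟨hy.1, by linarith⟩, hU, ?_⟩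
    simp only [stepPair, if_pos hx]
    rw [pamA hx0 hx, pamA hy.1 hy.2]
    exact hs.affine P.a1_ne
  · obtain ⟨l0, l1⟩ := g2 hx
    have hy : c ≤ y ∧ y < 1 := by unfold Seg at hs; grind
    refine ⟨⟨by linarith, hy.2⟩, hU, ?_⟩
    simp only [stepPair, if_neg hx]
    rw [pamB (not_lt.1 hx) hx1, pamB hy.1 hy.2]
    exact hs.affine P.a2_ne

theorem stepPair_fst (Q : ℚ × ℚ) (i : ℕ) :
    ((stepPair a1 b1 a2 b2 c)^[i] Q).1 = (pam2 a1 b1 a2 b2 c)^[i] Q.1 := by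
  induction i with
  | zero => rfl
  | succ n ih => rw [Function.iterate_succ_apply', Function.iterate_succ_apply', ← ih]; rfl

theorem cert1_sound (P : Prom a1 b1 a2 b2 c)
    (hx : x0 ∈ Set.Ico (0 : ℚ) 1) {n p : ℕ} {L : ℚ} (h : cert1 a1 b1 a2 b2 c x0 u v n p L) (k : ℕ) :
    ¬ hitP a1 b1 a2 b2 c x0 u v k := by
  obtain ⟨hp, h1, h2, h3, h4⟩ := h
  by_cases hk : k < n
  · exact h1 k hk
  set f := pam2 a1 b1 a2 b2 c with hf
  have hxn := P.iter_mem hx n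
  rw [← hf] at hxn
  set X := f^[n] x0 with hX
  have hXi : ∀ i, ((stepPair a1 b1 a2 b2 c)^[i] (X, L)).1 ∈ Set.Ico (0 : ℚ) 1 := by
    intro i; rw [stepPair_fst]; exact P.iter_mem hxn i
  have key : ∀ y, Seg X L y → ∀ i ≤ p, Seg ((stepPair a1 b1 a2 b2 c)^[i] (X, L)).1
      ((stepPair a1 b1 a2 b2 c)^[i] (X, L)).2 (f^[i] y) := by
    intro y hy i
    induction i with
    | zero => intro _; exact hy
    | succ i ih =>
      intro hi
      have := (goodPair_step P (hXi i) (h2 i (by omega)) (ih (by omega))).2.2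
      rw [Function.iterate_succ_apply', Function.iterate_succ_apply']
      exact this
  have main : ∀ k, ∀ y, Seg X L y → ¬ (u ≤ f^[k] y ∧ f^[k] y < v) := by
    intro k
    induction k using Nat.strong_induction_on with
    | _ k ih =>
      intro y hy
      by_cases hkp : k < p
      · exact (goodPair_step P (hXi k) (h2 k hkp) (key y hy k hkp.le)).2.1
      · have e : f^[k] y = f^[k - p] (f^[p] y) := by
          rw [← Function.iterate_add_apply]; congr 2; omega
        rw [e]
        apply ih _ (by omega)
        have := key y hy p le_rfl
        rw [h3, stepPair_fst] at this
        refine Seg.trans ?_ this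
        have e2 : f^[p] X = f^[n + p] x0 := by
          rw [hX, ← Function.iterate_add_apply, add_comm]
        change Seg X L (f^[p] X)
        rw [e2]; exact h4
  have e : f^[k] x0 = f^[k - n] X := by
    rw [hX, ← Function.iterate_add_apply]; congr 2; omega
  unfold hitP
  rw [← hf, e]
  exact main _ _ (Or.inl rfl)

/-- a point whose `m`-th iterate is in `[p,q)` lies in one of the pulled back intervals -/
theorem jstep_spec (P : Prom a1 b1 a2 b2 c) (ha1 : 0 < a1) (ha2 : 0 < a2) (m : ℕ) (p q : ℚ)
    (x : ℚ) (hx : x ∈ Set.Ico (0 : ℚ) 1) (hp : p ≤ (pam2 a1 b1 a2 b2 c)^[m] x)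
    (hq : (pam2 a1 b1 a2 b2 c)^[m] x < q) :
    ∃ w < 2 ^ m, ((jstep a1 b1 a2 b2 c)^[m] (w, (p, q))).2.1 ≤ x ∧
      x < ((jstep a1 b1 a2 b2 c)^[m] (w, (p, q))).2.2 := by
  induction m generalizing p q with
  | zero => exact ⟨0, by simp, hp, hq⟩
  | succ m ih =>
    rw [Function.iterate_succ_apply'] at hp hq
    have hy := P.iter_mem hx m
    generalize (pam2 a1 b1 a2 b2 c)^[m] x = y at *
    by_cases hyc : y < c
    · rw [pamA hy.1 hyc] at hp hq
      obtain ⟨w, hw, h1⟩ := ih (max 0 ((p - b1) / a1)) (min c ((q - b1) / a1))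
        (max_le hy.1 (by rw [div_le_iff₀ ha1]; linarith))
        (lt_min hyc (by rw [lt_div_iff₀ ha1]; linarith))
      refine ⟨2 * w, by rw [pow_succ]; omega, ?_⟩
      rw [Function.iterate_succ_apply]
      have e : jstep a1 b1 a2 b2 c (2 * w, (p, q)) =
        (w, (max 0 ((p - b1) / a1), min c ((q - b1) / a1))) := by
        simp [jstep]
      rw [e]; exact h1
    · push Not at hyc
      rw [pamB hyc hy.2] at hp hq
      obtain ⟨w, hw, h1⟩ := ih (max c ((p - b2) / a2)) (min 1 ((q - b2) / a2))
        (max_le hyc (by rw [div_le_iff₀ ha2]; linarith))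
        (lt_min hy.2 (by rw [lt_div_iff₀ ha2]; linarith))
      refine ⟨2 * w + 1, by rw [pow_succ]; omega, ?_⟩
      rw [Function.iterate_succ_apply]
      have e : jstep a1 b1 a2 b2 c (2 * w + 1, (p, q)) =
        (w, (max c ((p - b2) / a2), min 1 ((q - b2) / a2))) := by
        have h1 : (2 * w + 1) % 2 = 1 := by omega
        have h2 : (2 * w + 1) / 2 = w := by omega
        simp [jstep, h1, h2]
      rw [e]; exact h1

theorem jstep_spec' (P : Prom a1 b1 a2 b2 c) (ha1 : 0 < a1) (ha2 : 0 < a2) (m : ℕ) (p q : ℚ)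
    (hp0 : 0 ≤ p) (hq1 : q ≤ 1)
    (x : ℚ) (w : ℕ) (h1 : ((jstep a1 b1 a2 b2 c)^[m] (w, (p, q))).2.1 ≤ x)
    (h2 : x < ((jstep a1 b1 a2 b2 c)^[m] (w, (p, q))).2.2) :
    x ∈ Set.Ico (0 : ℚ) 1 ∧ p ≤ (pam2 a1 b1 a2 b2 c)^[m] x ∧ (pam2 a1 b1 a2 b2 c)^[m] x < q := by
  have hc0 := P.c0
  have hc1 := P.c1
  induction m generalizing p q w with
  | zero =>
    simp only [Function.iterate_zero, id] at *
    exact ⟨⟨by linarith, by linarith⟩, h1, h2⟩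
  | succ m ih =>
    rw [Function.iterate_succ_apply] at h1 h2
    rw [Function.iterate_succ_apply']
    by_cases hw : w % 2 = 0
    · have e : jstep a1 b1 a2 b2 c (w, (p, q)) =
        (w / 2, (max 0 ((p - b1) / a1), min c ((q - b1) / a1))) := by
        simp [jstep, hw]
      rw [e] at h1 h2
      obtain ⟨hx, h3, h4⟩ := ih _ _ (le_max_left _ _) ((min_le_left _ _).trans hc1.le) _ h1 h2
      rw [max_le_iff, div_le_iff₀ ha1] at h3
      rw [lt_min_iff, lt_div_iff₀ ha1] at h4
      refine ⟨hx, ?_⟩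
      rw [pamA h3.1 h4.1]
      constructor <;> linarith
    · have e : jstep a1 b1 a2 b2 c (w, (p, q)) =
        (w / 2, (max c ((p - b2) / a2), min 1 ((q - b2) / a2))) := by
        simp only [jstep, hw, if_false]
      rw [e] at h1 h2
      obtain ⟨hx, h3, h4⟩ := ih _ _ (hc0.le.trans (le_max_left _ _)) (min_le_left _ _) _ h1 h2
      rw [max_le_iff, div_le_iff₀ ha2] at h3
      rw [lt_min_iff, lt_div_iff₀ ha2] at h4
      refine ⟨hx, ?_⟩
      rw [pamB h3.1 h4.1]
      constructor <;> linarith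

theorem cert2_sound (P : Prom a1 b1 a2 b2 c)
    (hx : x0 ∈ Set.Ico (0 : ℚ) 1) {m : ℕ} (h : cert2 a1 b1 a2 b2 c x0 u v m) (k : ℕ) :
    ¬ hitP a1 b1 a2 b2 c x0 u v k := by
  obtain ⟨ha1, ha2, h1, h2⟩ := h
  by_cases hk : k < m
  · exact h1 k hk
  rintro ⟨h3, h4⟩
  have e : (pam2 a1 b1 a2 b2 c)^[k] x0 = (pam2 a1 b1 a2 b2 c)^[m] ((pam2 a1 b1 a2 b2 c)^[k - m] x0) := by
    rw [← Function.iterate_add_apply]; congr 2; omega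
  rw [e] at h3 h4
  obtain ⟨w, hw, h5, h6⟩ := jstep_spec P ha1 ha2 m u v _ (P.iter_mem hx _) h3 h4
  have := h2 w hw
  linarith

/-- if the second certificate fails for `m`, some point reaches the target in exactly `m` steps -/
theorem exists_of_not_cert2 (P : Prom a1 b1 a2 b2 c) (ha1 : 0 < a1) (ha2 : 0 < a2)
    (hu : 0 ≤ u) (hv : v ≤ 1) (h : ∀ k, ¬ hitP a1 b1 a2 b2 c x0 u v k) (m : ℕ)
    (hm : ¬ cert2 a1 b1 a2 b2 c x0 u v m) : ∃ x ∈ Set.Ico (0 : ℚ) 1,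
    u ≤ (pam2 a1 b1 a2 b2 c)^[m] x ∧ (pam2 a1 b1 a2 b2 c)^[m] x < v := by
  have : ∃ w < 2 ^ m, ((jstep a1 b1 a2 b2 c)^[m] (w, (u, v))).2.1 <
    ((jstep a1 b1 a2 b2 c)^[m] (w, (u, v))).2.2 := by
    by_contra hc
    push Not at hc
    exact hm ⟨ha1, ha2, fun j _ => h j, hc⟩
  obtain ⟨w, -, hw⟩ := this
  obtain ⟨h1, h2⟩ := jstep_spec' P ha1 ha2 m u v hu hv _ w le_rfl hw
  exact ⟨_, h1, h2⟩

end basics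

def EvPer (s : ℕ → Prop) : Prop := ∃ N p, 0 < p ∧ ∀ n, N ≤ n → (s (n + p) ↔ s n)

def affM (α β : ℕ → ℚ) (l : ℚ) : ℕ → ℚ
  | 0 => l
  | i + 1 => α i * affM α β l i + β i

theorem affM_sub (α β : ℕ → ℚ) (l l' : ℚ) (i : ℕ) :
    affM α β l i - affM α β l' i = (∏ j ∈ Finset.range i, α j) * (l - l') := by
  induction i with
  | zero => simp [affM]
  | succ i ih =>
    rw [Finset.prod_range_succ]
    simp only [affM]
    linear_combination α i * ih

theorem tendsto_geom (l e A : ℚ) (h0 : 0 < A) (h1 : A < 1) :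
    Filter.Tendsto (fun k : ℕ => l + A ^ k * e) Filter.atTop (nhds l) := by
  have := (tendsto_pow_atTop_nhds_zero_of_lt_one h0.le h1).mul_const e
  have := this.const_add l
  simpa using this

/-- the target is eventually on one side, together with the limit -/
theorem eventually_side (l e A u v : ℚ) (h0 : 0 < A) (h1 : A < 1) (he : e ≠ 0)
    (h : ∀ k : ℕ, ¬ (u ≤ l + A ^ k * e ∧ l + A ^ k * e < v)) :
    ∀ᶠ k : ℕ in Filter.atTop, (l + A ^ k * e < u ∧ l ≤ u) ∨ (v ≤ l + A ^ k * e ∧ v ≤ l) := by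
  have ht := tendsto_geom l e A h0 h1
  rcases he.lt_or_gt with he | he
  · have hlt : ∀ k : ℕ, l + A ^ k * e < l := fun k => by
      have := mul_neg_of_pos_of_neg (pow_pos h0 k) he
      linarith
    rcases le_or_gt l u with hl | hl
    · exact Filter.Eventually.of_forall (fun k => Or.inl ⟨(hlt k).trans_le hl, hl⟩)
    · filter_upwards [ht.eventually_const_lt hl] with k hk
      right
      have : v ≤ l + A ^ k * e := by
        by_contra hc
        exact h k ⟨hk.le, not_le.1 hc⟩
      exact ⟨this, this.trans (hlt k).le⟩
  · have hlt : ∀ k : ℕ, l < l + A ^ k * e := fun k => by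
      have := mul_pos (pow_pos h0 k) he
      linarith
    rcases le_or_gt v l with hl | hl
    · exact Filter.Eventually.of_forall (fun k => Or.inr ⟨hl.trans (hlt k).le, hl⟩)
    · filter_upwards [ht.eventually_lt_const hl] with k hk
      left
      have : l + A ^ k * e < u := by
        by_contra hc
        exact h k ⟨not_lt.1 hc, hk⟩
      exact ⟨this, ((hlt k).trans this).le⟩

theorem periodic_mul {s : ℕ → Prop} {N p : ℕ} (h : ∀ n, N ≤ n → (s (n + p) ↔ s n)) (k n : ℕ)
    (hn : N ≤ n) : s (n + k * p) ↔ s n := by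
  induction k with
  | zero => simp
  | succ k ih =>
    rw [← ih, Nat.succ_mul, ← add_assoc]
    exact h _ (by omega)

section
variable {a1 b1 a2 b2 c x0 u v : ℚ}

theorem cert1_of_evPer (P : Prom a1 b1 a2 b2 c)
    (hx : x0 ∈ Set.Ico (0 : ℚ) 1)
    (h : ∀ k, ¬ hitP a1 b1 a2 b2 c x0 u v k)
    (hs : EvPer (fun n => (pam2 a1 b1 a2 b2 c)^[n] x0 < c)) :
    ∃ n p L, cert1 a1 b1 a2 b2 c x0 u v n p L := by
  obtain ⟨N, p, hp, hper⟩ := hs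
  set f := pam2 a1 b1 a2 b2 c with hf
  set X : ℕ → ℚ := fun n => f^[n] x0 with hX
  have hXu : ∀ n, X n ∈ Set.Ico (0 : ℚ) 1 := fun n => P.iter_mem hx n
  have hXs : ∀ n, X (n + 1) = f (X n) := fun n => Function.iterate_succ_apply' f n x0
  have hit : ∀ n, ¬ (u ≤ X n ∧ X n < v) := h
  have hper' : ∀ k n, N ≤ n → (X (n + k * p) < c ↔ X n < c) := fun k n hn =>
    periodic_mul (s := fun n => X n < c) hper k n hn
  let α : ℕ → ℚ := fun i => if X (N + i) < c then a1 else a2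
  let β : ℕ → ℚ := fun i => if X (N + i) < c then b1 else b2
  have hα : ∀ i, α i ≠ 0 := by
    intro i
    by_cases h : X (N + i) < c
    · simp only [α, if_pos h]; exact P.a1_ne
    · simp only [α, if_neg h]; exact P.a2_ne
  have hαp : ∀ i, α (p + i) = α i := by
    intro i
    have : X (N + (p + i)) < c ↔ X (N + i) < c := by
      have := hper' 1 (N + i) (by omega)
      rw [← this]
      have e : N + (p + i) = N + i + 1 * p := by ring
      rw [e]
    simp only [α, this]
  let A : ℕ → ℚ := fun i => ∏ j ∈ Finset.range i, α j
  have hA2 : A (2 * p) = A p * A p := by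
    simp only [A]
    rw [two_mul, Finset.prod_range_add]
    congr 1
    exact Finset.prod_congr rfl (fun i _ => hαp i)
  have hAne : ∀ i, A i ≠ 0 := fun i => Finset.prod_ne_zero_iff.2 (fun j _ => hα j)
  have hApos : 0 < A (2 * p) := by
    rw [hA2]
    exact mul_self_pos.2 (hAne p)
  let Q := 2 * p
  -- the pair dynamics
  have hXstep : ∀ k i, X (N + k * Q + i + 1) = α i * X (N + k * Q + i) + β i := by
    intro k i
    rw [hXs]
    have e : N + k * Q + i = N + i + (2 * k) * p := by simp only [Q]; ring
    have hh := hper' (2 * k) (N + i) (by omega)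
    rw [← e] at hh
    by_cases hc : X (N + i) < c
    · simp only [α, β, if_pos hc]
      exact pamA (hXu _).1 (hh.2 hc)
    · simp only [α, β, if_neg hc]
      exact pamB (not_lt.1 (fun h => hc (hh.1 h))) (hXu _).2
  have hpair : ∀ k l i, (stepPair a1 b1 a2 b2 c)^[i] (X (N + k * Q), l) =
      (X (N + k * Q + i), affM α β l i) := by
    intro k l i
    induction i with
    | zero => rfl
    | succ i ih =>
      rw [Function.iterate_succ_apply', ih]
      simp only [stepPair]
      have e : N + k * Q + i = N + i + (2 * k) * p := by simp only [Q]; ring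
      have hh := hper' (2 * k) (N + i) (by omega)
      rw [← e] at hh
      ext
      · simp only; exact (hXs _).symm
      · simp only [affM, α, β, hh]
        split_ifs <;> rfl
  have hXM : ∀ k i, X (N + k * Q + i) = affM α β (X (N + k * Q)) i := by
    intro k i
    induction i with
    | zero => rfl
    | succ i ih => rw [← add_assoc, hXstep, affM, ih]
  have hkQ : ∀ k, N + (k + 1) * Q = N + k * Q + Q := fun k => by ring
  have hd : ∀ k, X (N + (k + 1) * Q) - X (N + k * Q) = A Q ^ k * (X (N + Q) - X N) := by
    intro k
    induction k with
    | zero => simp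
    | succ k ih =>
      rw [hkQ (k + 1), hXM (k + 1) Q]
      have e2 : X (N + (k + 1) * Q) = affM α β (X (N + k * Q)) Q := by rw [hkQ, hXM]
      have h1 := affM_sub α β (X (N + (k + 1) * Q)) (X (N + k * Q)) Q
      rw [← e2, ih] at h1
      rw [h1, pow_succ]
      simp only [A]; ring
  by_cases hfix : X (N + Q) = X N
  · refine ⟨N, Q, X N, by simp only [Q]; omega, fun j _ => h j, ?_, ?_, Or.inl hfix⟩
    · intro i hi
      have := hpair 0 (X N) i
      simp only [Nat.zero_mul, add_zero] at this
      have e := hXM 0 i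
      simp only [Nat.zero_mul, add_zero] at e
      change goodPair c u v ((stepPair a1 b1 a2 b2 c)^[i] (X N, X N))
      rw [this, ← e]
      refine ⟨fun h => ⟨(hXu _).1, h.le⟩, fun h => ⟨not_lt.1 h, (hXu _).2.le⟩, ?_⟩
      have := hit (N + i)
      simp only at *
      by_cases hc : u ≤ X (N + i)
      · right
        have : v ≤ X (N + i) := not_lt.1 (fun h => this ⟨hc, h⟩)
        exact ⟨this, this⟩
      · left; push Not at hc; exact ⟨hc, hc.le⟩
    · have := hpair 0 (X N) Q
      simp only [Nat.zero_mul, add_zero] at this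
      have e := hXM 0 Q
      simp only [Nat.zero_mul, add_zero] at e
      change ((stepPair a1 b1 a2 b2 c)^[Q] (X N, X N)).2 = X N
      rw [this]; simp only; rw [← e, hfix]
  -- contraction
  have hA1 : A Q < 1 := by
    by_contra hc
    push Not at hc
    have hone : ∀ k : ℕ, 1 ≤ A Q ^ k := fun k => one_le_pow₀ hc
    have hne : X (N + Q) - X N ≠ 0 := sub_ne_zero.2 hfix
    rcases hne.lt_or_gt with hd0 | hd0
    · have grow : ∀ k : ℕ, X (N + k * Q) - X N ≤ k * (X (N + Q) - X N) := by
        intro k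
        induction k with
        | zero => simp
        | succ k ih =>
          have h1 := hd k
          have h2 := mul_le_mul_of_nonpos_right (hone k) hd0.le
          push_cast
          linarith
      obtain ⟨k, hk⟩ := exists_nat_gt (1 / -(X (N + Q) - X N))
      have h1 := grow k
      rw [div_lt_iff₀ (by linarith)] at hk
      have h2 := (hXu (N + k * Q)).1
      have h3 := (hXu N).2
      linarith
    · have grow : ∀ k : ℕ, k * (X (N + Q) - X N) ≤ X (N + k * Q) - X N := by
        intro k
        induction k with
        | zero => simp
        | succ k ih =>
          have h1 := hd k
          have h2 := mul_le_mul_of_nonneg_right (hone k) hd0.le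
          push_cast
          linarith
      obtain ⟨k, hk⟩ := exists_nat_gt (1 / (X (N + Q) - X N))
      have h1 := grow k
      rw [div_lt_iff₀ (by linarith)] at hk
      have h2 := (hXu (N + k * Q)).2
      have h3 := (hXu N).1
      linarith
  let L : ℚ := affM α β 0 Q / (1 - A Q)
  have hL : affM α β L Q = L := by
    have h1 := affM_sub α β L 0 Q
    have h2 : L * (1 - A Q) = affM α β 0 Q := div_mul_cancel₀ _ (by linarith)
    have h3 : (∏ j ∈ Finset.range Q, α j) = A Q := rfl
    rw [h3] at h1
    linarith
  have hXL : ∀ k, X (N + k * Q) - L = A Q ^ k * (X N - L) := by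
    intro k
    induction k with
    | zero => simp
    | succ k ih =>
      rw [hkQ, hXM]
      nth_rewrite 1 [← hL]
      rw [affM_sub, ih, pow_succ]
      simp only [A]; ring
  have hXL' : ∀ k i, X (N + k * Q + i) = affM α β L i + A Q ^ k * (A i * (X N - L)) := by
    intro k i
    have h1 := affM_sub α β (X (N + k * Q)) L i
    rw [← hXM, hXL] at h1
    simp only [A] at h1 ⊢
    linarith
  have hNL : X N - L ≠ 0 := by
    intro h0
    apply hfix
    have h1 := hXL 1
    have h2 := hXL 0
    rw [h0] at h1 h2
    simp only [Nat.zero_mul, add_zero, one_mul] at h1 h2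
    linarith
  have hev : ∀ᶠ k : ℕ in Filter.atTop, ∀ i ∈ Finset.range Q,
      goodPair c u v (X (N + k * Q + i), affM α β L i) := by
    rw [Filter.eventually_all_finset]
    intro i _
    have hne : A i * (X N - L) ≠ 0 := mul_ne_zero (hAne i) hNL
    have ht := tendsto_geom (affM α β L i) (A i * (X N - L)) (A Q) hApos hA1
    have hside := eventually_side (affM α β L i) (A i * (X N - L)) (A Q) u v hApos hA1 hne
      (fun k => by rw [← hXL']; exact hit _)
    have hbr : ∀ k, (X (N + k * Q + i) < c ↔ X (N + i) < c) := by
      intro k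
      have e : N + k * Q + i = N + i + (2 * k) * p := by simp only [Q]; ring
      have hh := hper' (2 * k) (N + i) (by omega)
      rw [← e] at hh; exact hh
    filter_upwards [hside] with k hk
    rw [← hXL'] at hk
    refine ⟨fun h => ?_, fun h => ?_, hk⟩
    · simp only at h ⊢
      rw [hbr] at h
      constructor
      · refine ge_of_tendsto' ht (fun j => ?_)
        rw [← hXL']; exact (hXu _).1
      · refine le_of_tendsto' ht (fun j => ?_)
        rw [← hXL']; exact ((hbr j).2 h).le
    · simp only at h ⊢
      rw [hbr] at h
      constructor
      · refine ge_of_tendsto' ht (fun j => ?_)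
        rw [← hXL']; exact not_lt.1 (fun h' => h ((hbr j).1 h'))
      · refine le_of_tendsto' ht (fun j => ?_)
        rw [← hXL']; exact (hXu _).2.le
  obtain ⟨k, hk⟩ := hev.exists
  refine ⟨N + k * Q, Q, L, by simp only [Q]; omega, fun j _ => h j, ?_, ?_, ?_⟩
  · intro i hi
    have := hk i (Finset.mem_range.2 hi)
    rw [← hpair] at this
    exact this
  · change ((stepPair a1 b1 a2 b2 c)^[Q] (X (N + k * Q), L)).2 = L
    rw [hpair]; exact hL
  · change Seg (X (N + k * Q)) L (X (N + k * Q + Q))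
    rw [← hkQ]
    have h1 := hXL k
    have h2 := hXL (k + 1)
    have h3 : X (N + (k + 1) * Q) - L = A Q * (X (N + k * Q) - L) := by rw [h2, h1, pow_succ]; ring
    have h4 : X (N + k * Q) - L ≠ 0 := by rw [h1]; exact mul_ne_zero (pow_pos hApos k).ne' hNL
    right
    rcases h4.lt_or_gt with h5 | h5
    · left
      have h6 := mul_neg_of_pos_of_neg hApos h5
      constructor
      · nlinarith
      · linarith
    · right
      have h6 := mul_pos hApos h5
      constructor
      · linarith
      · nlinarith
end

open Filter in
theorem evPer_of_steps {s : ℕ → Prop} (k : ℕ) (hk : 0 < k)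
    (h : ∀ r, ∀ᶠ i : ℕ in atTop, (s (r + (i + 1) * k) ↔ s (r + i * k))) : EvPer s := by
  have h1 : ∀ᶠ i : ℕ in atTop, ∀ r ∈ Finset.range k, (s (r + (i + 1) * k) ↔ s (r + i * k)) := by
    rw [Filter.eventually_all_finset]
    exact fun r _ => h r
  obtain ⟨M, hM⟩ := eventually_atTop.1 h1
  refine ⟨M * k, k, hk, fun n hn => ?_⟩
  have h2 := hM (n / k) ((Nat.le_div_iff_mul_le hk).2 hn) (n % k) (Finset.mem_range.2 (Nat.mod_lt _ hk))
  have e : n % k + n / k * k = n := by rw [mul_comm]; exact Nat.mod_add_div n k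
  have e2 : n % k + (n / k + 1) * k = n + k := by rw [Nat.add_mul, one_mul, ← add_assoc, e]
  rwa [e, e2] at h2

open Filter in
theorem evPer_of_step {s : ℕ → Prop} (h : ∀ᶠ i : ℕ in atTop, (s (i + 1) ↔ s i)) : EvPer s := by
  obtain ⟨M, hM⟩ := eventually_atTop.1 h
  exact ⟨M, 1, one_pos, hM⟩

open Filter in
theorem eventually_of_persist {s : ℕ → Prop} (h : ∀ i, s i → s (i + 1)) :
    ∀ᶠ i : ℕ in atTop, (s (i + 1) ↔ s i) := by
  by_cases h1 : ∃ i, s i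
  · obtain ⟨i, hi⟩ := h1
    have h2 : ∀ j, i ≤ j → s j := fun j hj => Nat.le_induction hi (fun n _ hn => h n hn) j hj
    filter_upwards [eventually_ge_atTop i] with j hj
    exact ⟨fun _ => h2 j hj, fun _ => h2 (j + 1) (by omega)⟩
  · push Not at h1
    exact Eventually.of_forall (fun i => ⟨fun h => absurd h (h1 _), fun h => absurd h (h1 _)⟩)

open Filter in
theorem seqConst {s : ℕ → Prop} (h : ∀ i j, s i → ¬ s (i + 1) → ¬ s j → s (j + 1) → False) :
    ∀ᶠ i : ℕ in atTop, (s (i + 1) ↔ s i) := by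
  by_cases h1 : ∃ i, s i ∧ ¬ s (i + 1)
  · obtain ⟨i, hi, hi'⟩ := h1
    have h2 : ∀ j, ¬ s j → ¬ s (j + 1) := fun j hj hj' => h i j hi hi' hj hj'
    filter_upwards [eventually_of_persist (s := fun i => ¬ s i) h2] with j hj
    exact not_iff_not.1 hj
  · push Not at h1
    exact eventually_of_persist h1

open Filter in
theorem mono_threshold {β : Type*} [LinearOrder β] (g : ℕ → β) (hg : Monotone g ∨ Antitone g)
    (c : β) : ∀ᶠ i : ℕ in atTop, (g (i + 1) < c ↔ g i < c) := by
  rcases hg with hg | hg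
  · have := eventually_of_persist (s := fun i => ¬ g i < c)
      (fun i hi h => hi ((hg (Nat.le_succ i)).trans_lt h))
    filter_upwards [this] with j hj
    exact not_iff_not.1 hj
  · exact eventually_of_persist (s := fun i => g i < c) (fun i hi => (hg (Nat.le_succ i)).trans_lt hi)

/-- a sequence whose order is propagated is monotone -/
theorem mono_of_step {β : Type*} [LinearOrder β] (g : ℕ → β)
    (h1 : ∀ i, g i ≤ g (i + 1) → g (i + 1) ≤ g (i + 2))
    (h2 : ∀ i, g (i + 1) ≤ g i → g (i + 2) ≤ g (i + 1)) : Monotone g ∨ Antitone g := by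
  rcases le_total (g 0) (g 1) with h | h
  · left
    apply monotone_nat_of_le_succ
    intro n
    induction n with
    | zero => exact h
    | succ n ih => exact h1 n ih
  · right
    apply antitone_nat_of_succ_le
    intro n
    induction n with
    | zero => exact h
    | succ n ih => exact h2 n ih

open Filter in
/-- the flip lemma: increasing on the left piece, decreasing on the right piece -/
theorem flip_evPer {β : Type*} [LinearOrder β] (x : ℕ → β) (s : ℕ → Prop)
    (h1 : ∀ i j, s i → ¬ s j → x i < x j)
    (h2 : ∀ i j, s i → ¬ s j → x (j + 1) < x (i + 1))
    (h3 : ∀ i j, s i → s j → x i < x j → x (i + 1) < x (j + 1))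
    (h4 : ∀ i j, ¬ s i → ¬ s j → x i < x j → x (j + 1) < x (i + 1))
    (h5 : ∀ i j, x i = x j → x (i + 1) = x (j + 1)) : EvPer s := by
  classical
  by_cases hinf : ∀ n, ∃ j, 1 ≤ j ∧ ¬ s (n + j)
  swap
  · push Not at hinf
    obtain ⟨n, hn⟩ := hinf
    refine ⟨n + 1, 1, one_pos, fun m hm => ?_⟩
    have e1 : m = n + (m - n) := by omega
    have e2 : m + 1 = n + (m + 1 - n) := by omega
    have a1 := hn (m - n) (by omega)
    have a2 := hn (m + 1 - n) (by omega)
    rw [← e1] at a1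
    rw [← e2] at a2
    exact ⟨fun _ => a1, fun _ => a2⟩
  let r : ℕ → ℕ := fun n => Nat.find (hinf n)
  have r1 : ∀ n, 1 ≤ r n := fun n => (Nat.find_spec (hinf n)).1
  have r2 : ∀ n, ¬ s (n + r n) := fun n => (Nat.find_spec (hinf n)).2
  have r3 : ∀ n i, 1 ≤ i → i < r n → s (n + i) := by
    intro n i hi hir
    by_contra hc
    exact Nat.find_min (hinf n) hir ⟨hi, hc⟩
  -- key comparison
  have K : ∀ m n, ¬ s m → ¬ s n → ∀ j, 1 ≤ j → (∀ i, 1 ≤ i → i < j → s (m + i)) →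
      (∀ i, 1 ≤ i → i ≤ j → s (n + i)) → x (m + j) < x (n + j + 1) := by
    intro m n hm hn j hj
    induction j, hj using Nat.le_induction with
    | base =>
      intro _ hb
      exact h2 (n + 1) m (hb 1 le_rfl le_rfl) hm
    | succ j hj ih =>
      intro ha hb
      have := ih (fun i hi hij => ha i hi (by omega)) (fun i hi hij => hb i hi (by omega))
      exact h3 _ _ (ha j hj (by omega)) (hb (j + 1) (by omega) le_rfl) this
  have R : ∀ m n, ¬ s m → ¬ s n → r n ≤ r m + 1 := by
    intro m n hm hn
    by_contra hc
    push Not at hc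
    have hlt := K m n hm hn (r m) (r1 m) (fun i hi hir => r3 m i hi hir)
      (fun i hi hir => r3 n i hi (by omega))
    have hs := r3 n (r m + 1) (by omega) hc
    exact absurd (h1 _ _ hs (r2 m)) (not_lt.2 hlt.le)
  -- minimal return time
  have hexB : ∃ n, ¬ s n := ⟨_, r2 0⟩
  have hexN : ∃ N, ∃ n, ¬ s n ∧ r n = N := by
    obtain ⟨n, hn⟩ := hexB
    exact ⟨r n, n, hn, rfl⟩
  obtain ⟨m0, hm0, hm0N⟩ := Nat.find_spec hexN
  set N := Nat.find hexN with hN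
  have hNle : ∀ n, ¬ s n → N ≤ r n := fun n hn => Nat.find_min' hexN ⟨n, hn, rfl⟩
  have hN2 : ∀ n, ¬ s n → r n = N ∨ r n = N + 1 := by
    intro n hn
    have := R m0 n hm0 hn
    have := hNle n hn
    omega
  have hN1 : 1 ≤ N := hm0N ▸ r1 m0
  have CC : ∀ m n, ¬ s m → ¬ s n → r m = N → r n = N + 1 → x m < x n := by
    intro m n hm hn hmr hnr
    have hfin : x (n + N) < x (m + N) := h1 _ _ (r3 n N hN1 (by omega)) (hmr ▸ r2 m)
    by_contra hc
    push Not at hc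
    rcases hc.lt_or_eq with hlt | heq
    · have : ∀ j, 1 ≤ j → j ≤ N → x (m + j) < x (n + j) := by
        intro j hj
        induction j, hj using Nat.le_induction with
        | base => intro _; exact h4 _ _ hn hm hlt
        | succ j hj ih =>
          intro hjN
          exact h3 _ _ (r3 m j hj (by omega)) (r3 n j hj (by omega)) (ih (by omega))
      exact absurd hfin (not_lt.2 (this N hN1 le_rfl).le)
    · have e : ∀ j, x (m + j) = x (n + j) := by
        intro j
        induction j with
        | zero => exact heq.symm
        | succ j ih => exact h5 _ _ ih
      exact absurd hfin (not_lt.2 (e N).le)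
  let T : ℕ → ℕ := fun k => Nat.rec (motive := fun _ => ℕ) (0 + r 0) (fun _ t => t + r t) k
  have T0 : ∀ k, ¬ s (T k) := by
    intro k
    cases k with
    | zero => exact r2 0
    | succ k => exact r2 (T k)
  have Ts : ∀ k, T (k + 1) = T k + r (T k) := fun k => rfl
  have hconst := seqConst (s := fun k => r (T k) = N) (by
    intro i j hi hi' hj hj'
    have hi1 := (hN2 _ (T0 (i + 1))).resolve_left hi'
    have hj1 := (hN2 _ (T0 j)).resolve_left hj
    have c1 := CC _ _ (T0 (j + 1)) (T0 (i + 1)) hj' hi1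
    have c2 := K (T i) (T j) (T0 i) (T0 j) N hN1 (fun l hl hlN => r3 _ l hl (by omega))
      (fun l hl hlN => r3 _ l hl (by omega))
    rw [Ts, Ts, hi, hj1] at c1
    exact absurd c1 (not_lt.2 c2.le))
  obtain ⟨k0, hk0⟩ := eventually_atTop.1 hconst
  have hM : ∀ k, r (T (k0 + k)) = r (T k0) := by
    have : ∀ k, (r (T (k0 + k)) = N ↔ r (T k0) = N) := by
      intro k
      induction k with
      | zero => exact Iff.rfl
      | succ k ih => rw [← ih]; exact hk0 (k0 + k) (by omega)
    intro k
    have a := this k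
    rcases hN2 _ (T0 (k0 + k)) with b | b <;> rcases hN2 _ (T0 k0) with b' | b'
    · rw [b, b']
    · exact absurd (a.1 b) (by omega)
    · exact absurd (a.2 b') (by omega)
    · rw [b, b']
  set M := r (T k0) with hMdef
  have hM1 : 1 ≤ M := r1 _
  have hT : ∀ k, T (k0 + k) = T k0 + k * M := by
    intro k
    induction k with
    | zero => simp
    | succ k ih => rw [← add_assoc, Ts, hM, ih]; ring
  have hpat : ∀ q i, i < M → (s (T k0 + q * M + i) ↔ i ≠ 0) := by
    intro q i hi
    rw [← hT]
    constructor
    · rintro h rfl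
      exact T0 _ h
    · intro h
      exact r3 _ i (by omega) (by rw [hM]; exact hi)
  refine ⟨T k0, M, hM1, fun n hn => ?_⟩
  have e := Nat.mod_add_div (n - T k0) M
  have e1 : n = T k0 + (n - T k0) / M * M + (n - T k0) % M := by
    rw [mul_comm]; omega
  have e2 : n + M = T k0 + ((n - T k0) / M + 1) * M + (n - T k0) % M := by
    rw [add_mul, one_mul]; omega
  have hlt := Nat.mod_lt (n - T k0) (show M > 0 from hM1)
  rw [e2, hpat _ _ hlt]
  conv_rhs => rw [e1, hpat _ _ hlt]

section
variable {a1 b1 a2 b2 c x0 u v : ℚ}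

theorem Prom.dichotomy (P : Prom a1 b1 a2 b2 c) :
    (∀ x y, 0 ≤ x → x < c → c ≤ y → y < 1 → a1 * x + b1 < a2 * y + b2) ∨
    (∀ x y, 0 ≤ x → x < c → c ≤ y → y < 1 → a2 * y + b2 < a1 * x + b1) := by
  have hc0 := P.c0
  have hc1 := P.c1
  have hne : ∀ x y, 0 ≤ x → x < c → c ≤ y → y < 1 → a1 * x + b1 ≠ a2 * y + b2 := by
    intro x y h1 h2 h3 h4 he
    have := P.inj (x₁ := x) (x₂ := y) ⟨h1, by linarith⟩ ⟨by linarith, h4⟩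
      (by rw [pamA h1 h2, pamB h3 h4, he])
    linarith
  by_contra hcon
  push Not at hcon
  obtain ⟨⟨x, y, hx0, hx1, hy0, hy1, h⟩, ⟨x', y', hx0', hx1', hy0', hy1', h'⟩⟩ := hcon
  set A := a1 * x + b1 - (a2 * y + b2) with hA
  set B := a2 * y' + b2 - (a1 * x' + b1) with hB
  have hA0 : 0 < A := by
    have := hne x y hx0 hx1 hy0 hy1
    rcases h.lt_or_eq with h | h
    · linarith
    · exact absurd h.symm this
  have hB0 : 0 < B := by
    have := hne x' y' hx0' hx1' hy0' hy1'
    rcases h'.lt_or_eq with h | h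
    · linarith
    · exact absurd h this
  have hs : 0 < A + B := by linarith
  -- convex combination
  refine hne ((B * x + A * x') / (A + B)) ((B * y + A * y') / (A + B)) ?_ ?_ ?_ ?_ ?_
  · positivity
  · rw [div_lt_iff₀ hs]; nlinarith
  · rw [le_div_iff₀ hs]; nlinarith
  · rw [div_lt_iff₀ hs]; nlinarith
  · field_simp
    rw [hA, hB]; ring

open Filter in
theorem evPer_easy (P : Prom a1 b1 a2 b2 c) (hx : x0 ∈ Set.Ico (0 : ℚ) 1)
    (h : (∀ x y, 0 ≤ x → x < c → c ≤ y → y < 1 → a1 * x + b1 < a2 * y + b2) ∨ a1 < 0 ∨ a2 < 0) :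
    EvPer (fun n => (pam2 a1 b1 a2 b2 c)^[n] x0 < c) := by
  set f := pam2 a1 b1 a2 b2 c with hf
  set X : ℕ → ℚ := fun n => f^[n] x0 with hX
  have hXu : ∀ n, X n ∈ Set.Ico (0 : ℚ) 1 := fun n => P.iter_mem hx n
  have hXs : ∀ n, X (n + 1) = f (X n) := fun n => Function.iterate_succ_apply' f n x0
  have XA : ∀ n, X n < c → X (n + 1) = a1 * X n + b1 := fun n h => by
    rw [hXs]; exact pamA (hXu n).1 h
  have XB : ∀ n, ¬ X n < c → X (n + 1) = a2 * X n + b2 := fun n h => by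
    rw [hXs]; exact pamB (not_lt.1 h) (hXu n).2
  change EvPer (fun n => X n < c)
  by_cases hlt : ∀ x y, 0 ≤ x → x < c → c ≤ y → y < 1 → a1 * x + b1 < a2 * y + b2
  · apply evPer_of_step
    refine seqConst (s := fun n => X n < c) ?_
    intro i j h1 h2 h3 h4
    have := hlt (X i) (X j) (hXu _).1 h1 (not_lt.1 h3) (hXu _).2
    rw [← XA i h1, ← XB j h3] at this
    linarith
  have hgt := (P.dichotomy).resolve_left hlt
  have h' := h.resolve_left hlt
  have k1 : ∀ i j, X i < c → ¬ X j < c → X i < X j := fun i j h1 h2 => by linarith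
  have k2 : ∀ i j, X i < c → ¬ X j < c → X (j + 1) < X (i + 1) := fun i j h1 h2 => by
    rw [XA i h1, XB j h2]
    exact hgt _ _ (hXu _).1 h1 (not_lt.1 h2) (hXu _).2
  have k5 : ∀ i j, X i = X j → X (i + 1) = X (j + 1) := fun i j h => by rw [hXs, hXs, h]
  rcases P.a1_ne.lt_or_gt with ha1 | ha1
  · rcases P.a2_ne.lt_or_gt with ha2 | ha2
    · -- both negative
      have anti : ∀ i j, X i ≤ X j → X (j + 1) ≤ X (i + 1) := by
        intro i j hij
        by_cases hi : X i < c <;> by_cases hj : X j < c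
        · rw [XA i hi, XA j hj]; nlinarith
        · exact (k2 i j hi hj).le
        · linarith
        · rw [XB i hi, XB j hj]; nlinarith
      refine evPer_of_steps 2 two_pos (fun r => ?_)
      refine mono_threshold (fun i => X (r + i * 2)) (mono_of_step _ ?_ ?_) c
      · intro i hi
        have := anti _ _ (anti _ _ hi)
        have e1 : r + (i + 2) * 2 = r + (i + 1) * 2 + 1 + 1 := by ring
        have e2 : r + (i + 1) * 2 = r + i * 2 + 1 + 1 := by ring
        rw [e1]
        nth_rewrite 1 [e2]
        exact this
      · intro i hi
        have := anti _ _ (anti _ _ hi)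
        have e1 : r + (i + 2) * 2 = r + (i + 1) * 2 + 1 + 1 := by ring
        have e2 : r + (i + 1) * 2 = r + i * 2 + 1 + 1 := by ring
        rw [e1]
        nth_rewrite 2 [e2]
        exact this
    · -- decreasing on the left, increasing on the right
      have := flip_evPer (β := ℚᵒᵈ) (fun n => OrderDual.toDual (X n)) (fun n => ¬ X n < c)
        (fun i j hi hj => k1 j i (not_not.1 hj) hi)
        (fun i j hi hj => k2 j i (not_not.1 hj) hi)
        (fun i j hi hj hij => by
          have hij' : X j < X i := hij
          change X (j + 1) < X (i + 1)
          rw [XB i hi, XB j hj]; nlinarith)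
        (fun i j hi hj hij => by
          have hij' : X j < X i := hij
          change X (i + 1) < X (j + 1)
          rw [XA i (not_not.1 hi), XA j (not_not.1 hj)]; nlinarith)
        (fun i j hij => k5 i j hij)
      obtain ⟨N, p, hp, hper⟩ := this
      exact ⟨N, p, hp, fun n hn => not_iff_not.1 (hper n hn)⟩
  · have ha2 : a2 < 0 := h'.resolve_left (not_lt.2 ha1.le)
    exact flip_evPer X (fun n => X n < c) k1 k2
      (fun i j hi hj hij => by rw [XA i hi, XA j hj]; nlinarith)
      (fun i j hi hj hij => by rw [XB i hi, XB j hj]; nlinarith) k5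
end

/-- orientation-preserving flip case -/
structure CaseB (a1 b1 a2 b2 c : ℚ) : Prop where
  P : Prom a1 b1 a2 b2 c
  ha1 : 0 < a1
  ha2 : 0 < a2
  hgt : ∀ x y, 0 ≤ x → x < c → c ≤ y → y < 1 → a2 * y + b2 < a1 * x + b1

def cyc (a b c : ℚ) : Prop := (a < b ∧ b < c) ∨ (b < c ∧ c < a) ∨ (c < a ∧ a < b)

/-- circle unrolled at `v` -/
def unroll (v y : ℚ) : ℚ := if v ≤ y then y else y + 1

theorem unroll_lt_iff {u v z y y' : ℚ} (hz : u ≤ z ∧ z < v) (h0 : 0 ≤ y) (h1 : y < 1) (h0' : 0 ≤ y')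
    (h1' : y' < 1) (hy : ¬ (u ≤ y ∧ y < v)) (hy' : ¬ (u ≤ y' ∧ y' < v)) :
    unroll v y < unroll v y' ↔ cyc z y y' := by
  unfold unroll cyc
  obtain ⟨hz1, hz2⟩ := hz
  by_cases h : v ≤ y <;> by_cases h' : v ≤ y' <;> simp only [h, h', if_true, if_false] <;>
    constructor <;> intro hh <;> grind

section
variable {a1 b1 a2 b2 c x0 u v : ℚ}

theorem CaseB.facts (H : CaseB a1 b1 a2 b2 c) :
    0 ≤ a2 * c + b2 ∧ a2 + b2 ≤ b1 ∧ 0 < b1 ∧ b1 < 1 ∧ a1 * c + b1 ≤ 1 := by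
  have hc0 := H.P.c0
  have hc1 := H.P.c1
  have ha1 := H.ha1
  have ha2 := H.ha2
  have f0 := H.P.maps 0 ⟨le_rfl, by linarith⟩
  rw [pamA le_rfl hc0] at f0
  have fc := H.P.maps c ⟨hc0.le, hc1⟩
  rw [pamB le_rfl hc1] at fc
  have g := H.hgt 0 c le_rfl hc0 le_rfl hc1
  refine ⟨fc.1, ?_, by linarith [fc.1], by linarith [f0.2], ?_⟩
  · by_contra hcon
    push Not at hcon
    -- choose y close to one
    have hy : ∃ y, c ≤ y ∧ y < 1 ∧ b1 ≤ a2 * y + b2 := by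
      refine ⟨max c ((b1 - b2) / a2), le_max_left _ _, ?_, ?_⟩
      · refine max_lt hc1 ?_
        rw [div_lt_one ha2]; linarith
      · have h1 := le_max_right c ((b1 - b2) / a2)
        rw [div_le_iff₀ ha2] at h1
        linarith
    obtain ⟨y, y1, y2, y3⟩ := hy
    have := H.hgt 0 y le_rfl hc0 y1 y2
    linarith
  · by_contra hcon
    push Not at hcon
    have hy : ∃ y, 0 ≤ y ∧ y < c ∧ 1 ≤ a1 * y + b1 := by
      refine ⟨max 0 ((1 - b1) / a1), le_max_left _ _, ?_, ?_⟩
      · refine max_lt hc0 ?_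
        rw [div_lt_iff₀ ha1]; linarith
      · have h1 := le_max_right 0 ((1 - b1) / a1)
        rw [div_le_iff₀ ha1] at h1
        linarith
    obtain ⟨y, y1, y2, y3⟩ := hy
    have := (H.P.maps y ⟨y1, by linarith⟩).2
    rw [pamA y1 y2] at this
    linarith

theorem CaseB.pair (H : CaseB a1 b1 a2 b2 c) {x y : ℚ} (hx : x ∈ Set.Ico (0 : ℚ) 1)
    (hy : y ∈ Set.Ico (0 : ℚ) 1) (hxy : x < y) :
    ((x < c ↔ y < c) ∧ pam2 a1 b1 a2 b2 c x < pam2 a1 b1 a2 b2 c y) ∨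
    (x < c ∧ ¬ y < c ∧ pam2 a1 b1 a2 b2 c y < pam2 a1 b1 a2 b2 c x) := by
  have ha1 := H.ha1
  have ha2 := H.ha2
  by_cases h1 : x < c <;> by_cases h2 : y < c
  · left
    refine ⟨by tauto, ?_⟩
    rw [pamA hx.1 h1, pamA hy.1 h2]; nlinarith
  · right
    refine ⟨h1, h2, ?_⟩
    rw [pamA hx.1 h1, pamB (not_lt.1 h2) hy.2]
    exact H.hgt _ _ hx.1 h1 (not_lt.1 h2) hy.2
  · exact absurd (hxy.trans h2) h1
  · left
    refine ⟨by tauto, ?_⟩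
    rw [pamB (not_lt.1 h1) hx.2, pamB (not_lt.1 h2) hy.2]; nlinarith

theorem CaseB.cyc1 (H : CaseB a1 b1 a2 b2 c) {x y z : ℚ} (hx : x ∈ Set.Ico (0 : ℚ) 1)
    (hy : y ∈ Set.Ico (0 : ℚ) 1) (hz : z ∈ Set.Ico (0 : ℚ) 1) (h : x < y) (h' : y < z) :
    cyc (pam2 a1 b1 a2 b2 c x) (pam2 a1 b1 a2 b2 c y) (pam2 a1 b1 a2 b2 c z) := by
  have p1 := H.pair hx hy h
  have p2 := H.pair hy hz h'
  have p3 := H.pair hx hz (h.trans h')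
  unfold cyc
  generalize pam2 a1 b1 a2 b2 c x = X at *
  generalize pam2 a1 b1 a2 b2 c y = Y at *
  generalize pam2 a1 b1 a2 b2 c z = Z at *
  grind

theorem cyc_rot {a b c : ℚ} (h : cyc a b c) : cyc b c a := by
  unfold cyc at *; tauto

theorem CaseB.cyc (H : CaseB a1 b1 a2 b2 c) {x y z : ℚ} (hx : x ∈ Set.Ico (0 : ℚ) 1)
    (hy : y ∈ Set.Ico (0 : ℚ) 1) (hz : z ∈ Set.Ico (0 : ℚ) 1) (h : cyc x y z) :
    cyc (pam2 a1 b1 a2 b2 c x) (pam2 a1 b1 a2 b2 c y) (pam2 a1 b1 a2 b2 c z) := by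
  rcases h with ⟨h, h'⟩ | ⟨h, h'⟩ | ⟨h, h'⟩
  · exact H.cyc1 hx hy hz h h'
  · exact cyc_rot (cyc_rot (H.cyc1 hy hz hx h h'))
  · exact cyc_rot (H.cyc1 hz hx hy h h')

theorem CaseB.cyc_iter (H : CaseB a1 b1 a2 b2 c) {x y z : ℚ} (hx : x ∈ Set.Ico (0 : ℚ) 1)
    (hy : y ∈ Set.Ico (0 : ℚ) 1) (hz : z ∈ Set.Ico (0 : ℚ) 1) (h : _root_.cyc x y z) (k : ℕ) :
    _root_.cyc ((pam2 a1 b1 a2 b2 c)^[k] x) ((pam2 a1 b1 a2 b2 c)^[k] y)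
      ((pam2 a1 b1 a2 b2 c)^[k] z) := by
  induction k with
  | zero => exact h
  | succ k ih =>
    simp only [Function.iterate_succ_apply']
    exact H.cyc (H.P.iter_mem hx k) (H.P.iter_mem hy k) (H.P.iter_mem hz k) ih

/-- if some point of the target returns to the target, orbits avoiding the target have
eventually periodic itineraries -/
theorem CaseB.evPer_of_return (H : CaseB a1 b1 a2 b2 c) (hx : x0 ∈ Set.Ico (0 : ℚ) 1)
    (h : ∀ k, ¬ hitP a1 b1 a2 b2 c x0 u v k) {z : ℚ} (hz : z ∈ Set.Ico (0 : ℚ) 1) {k : ℕ}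
    (hk : 0 < k) (hzU : u ≤ z ∧ z < v)
    (hzU' : u ≤ (pam2 a1 b1 a2 b2 c)^[k] z ∧ (pam2 a1 b1 a2 b2 c)^[k] z < v) :
    EvPer (fun n => (pam2 a1 b1 a2 b2 c)^[n] x0 < c) := by
  set f := pam2 a1 b1 a2 b2 c with hf
  set X : ℕ → ℚ := fun n => f^[n] x0 with hX
  have hXu : ∀ n, X n ∈ Set.Ico (0 : ℚ) 1 := fun n => H.P.iter_mem hx n
  have hXk : ∀ n, X (n + k) = f^[k] (X n) := fun n => by
    simp only [hX]; rw [← Function.iterate_add_apply, add_comm]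
  have hit : ∀ n, ¬ (u ≤ X n ∧ X n < v) := h
  have key : ∀ m n, unroll v (X m) < unroll v (X n) → unroll v (X (m + k)) < unroll v (X (n + k)) := by
    intro m n hmn
    rw [unroll_lt_iff hzU (hXu m).1 (hXu m).2 (hXu n).1 (hXu n).2 (hit m) (hit n)] at hmn
    rw [unroll_lt_iff hzU' (hXu _).1 (hXu _).2 (hXu _).1 (hXu _).2 (hit _) (hit _), hXk, hXk]
    exact H.cyc_iter hz (hXu m) (hXu n) hmn k
  have hinj : ∀ m n, unroll v (X m) = unroll v (X n) → X m = X n := by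
    intro m n hmn
    have h1 := hXu m
    have h2 := hXu n
    obtain ⟨h1, h1'⟩ := h1
    obtain ⟨h2, h2'⟩ := h2
    unfold unroll at hmn
    split_ifs at hmn <;> linarith
  have keyle : ∀ m n, unroll v (X m) ≤ unroll v (X n) →
      unroll v (X (m + k)) ≤ unroll v (X (n + k)) := by
    intro m n hmn
    rcases hmn.lt_or_eq with hlt | heq
    · exact (key m n hlt).le
    · rw [hXk, hXk, hinj m n heq]
  change EvPer (fun n => X n < c)
  refine evPer_of_steps k hk (fun r => ?_)
  have hmono : Monotone (fun i => unroll v (X (r + i * k))) ∨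
      Antitone (fun i => unroll v (X (r + i * k))) := by
    have e1 : ∀ i, r + (i + 1) * k = r + i * k + k := fun i => by ring
    refine mono_of_step _ ?_ ?_
    · intro i hi
      have := keyle _ _ hi
      rw [← e1, ← e1] at this
      exact this
    · intro i hi
      have := keyle _ _ hi
      rw [← e1, ← e1] at this
      exact this
  have hchar : ∀ n, (X n < c ↔ (unroll v (X n) < c ∨ (¬ unroll v (X n) < 1 ∧ unroll v (X n) < 1 + c))) := by
    intro n
    obtain ⟨h1, h1'⟩ := hXu n
    have hc := H.P.c1
    unfold unroll
    split_ifs <;> constructor <;> intro hh <;> grind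
  filter_upwards [mono_threshold _ hmono c, mono_threshold _ hmono 1, mono_threshold _ hmono (1 + c)]
    with i h1 h2 h3
  rw [hchar, hchar, h1, h2, h3]
end

theorem CaseB.key (H : CaseB a1 b1 a2 b2 c) : (a2 - 1) * b1 ≤ (a1 - 1) * b2 := by
  obtain ⟨h1, h2, h3, h4, h5⟩ := H.facts
  have hc0 := H.P.c0
  have hc1 := H.P.c1
  have ha1 := H.ha1
  have ha2 := H.ha2
  have e : a2 * (1 - c) ≤ b1 := by linarith
  rcases le_total 1 a1 with h | h
  · have e1 : (a1 - 1) * (-(a2 * c)) ≤ (a1 - 1) * b2 :=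
      mul_le_mul_of_nonneg_left (by linarith) (by linarith)
    have e2 : a2 * ((a1 - 1) * c) ≤ a2 * (1 - c - b1) :=
      mul_le_mul_of_nonneg_left (by linarith) ha2.le
    nlinarith
  · have e1 : (1 - a1) * b2 ≤ (1 - a1) * (b1 - a2) :=
      mul_le_mul_of_nonneg_left (by linarith) (by linarith)
    have e2 : a2 * (a1 + b1 - 1) ≤ a2 * (a1 * (1 - c)) :=
      mul_le_mul_of_nonneg_left (by linarith) ha2.le
    have e3 : a1 * (a2 * (1 - c)) ≤ a1 * b1 := mul_le_mul_of_nonneg_left e ha1.le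
    nlinarith

theorem log_ineq {p q r s : ℚ} (hp : 0 < p) (hq : 0 < q) (hr : 0 < r) (hs : 0 < s)
    (h : p * q ≤ r * s) :
    Real.log (p : ℝ) + Real.log (q : ℝ) ≤ Real.log (r : ℝ) + Real.log (s : ℝ) := by
  have hp' : (0 : ℝ) < p := by exact_mod_cast hp
  have hq' : (0 : ℝ) < q := by exact_mod_cast hq
  have hr' : (0 : ℝ) < r := by exact_mod_cast hr
  have hs' : (0 : ℝ) < s := by exact_mod_cast hs
  rw [← Real.log_mul hp'.ne' hq'.ne', ← Real.log_mul hr'.ne' hs'.ne']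
  exact Real.log_le_log (by positivity) (by exact_mod_cast h)

theorem log_strict {p q : ℚ} (hp : 0 < p) (h : p < q) : Real.log (p : ℝ) < Real.log (q : ℝ) :=
  Real.log_lt_log (by exact_mod_cast hp) (by exact_mod_cast h)

theorem CaseB.potential (H : CaseB a1 b1 a2 b2 c) : ∃ Φ : ℚ → ℝ,
    (∀ x y, 0 ≤ x → x < y → y ≤ 1 → Φ x < Φ y) ∧
    (∀ x y, 0 ≤ x → x ≤ y → y ≤ c → Φ (a1 * y + b1) - Φ (a1 * x + b1) ≤ Φ y - Φ x) ∧
    (∀ x y, c ≤ x → x ≤ y → y ≤ 1 → Φ (a2 * y + b2) - Φ (a2 * x + b2) ≤ Φ y - Φ x) := by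
  obtain ⟨h1, h2, h3, h4, h5⟩ := H.facts
  have hc0 := H.P.c0
  have hc1 := H.P.c1
  have ha1 := H.ha1
  have ha2 := H.ha2
  have hk := H.key
  have rA : ∀ x, 0 ≤ x → x ≤ c → 0 ≤ a1 * x + b1 ∧ a1 * x + b1 ≤ 1 := fun x hx hx' =>
    ⟨by positivity, by nlinarith⟩
  have rB : ∀ x, c ≤ x → x ≤ 1 → 0 ≤ a2 * x + b2 ∧ a2 * x + b2 ≤ 1 := fun x hx hx' =>
    ⟨by nlinarith, by nlinarith⟩
  by_cases g1 : 1 < a1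
  · obtain ⟨κ, hκ⟩ : ∃ κ, κ = (a1 - 1) / b1 := ⟨_, rfl⟩
    have hκ0 : 0 < κ := by rw [hκ]; exact div_pos (by linarith) h3
    have e1 : a1 - 1 = κ * b1 := by rw [hκ]; field_simp
    have e2 : a2 - 1 ≤ κ * b2 := by
      have : κ * b2 = (a1 - 1) * b2 / b1 := by rw [hκ]; ring
      rw [this, le_div_iff₀ h3]; exact hk
    have pos : ∀ x, 0 ≤ x → 0 < 1 + κ * x := fun x hx => by positivity
    have gen : ∀ a b x y : ℚ, a - 1 ≤ κ * b → 0 ≤ x → x ≤ y → 0 ≤ a * x + b → 0 ≤ a * y + b →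
        Real.log ((1 + κ * (a * y + b) : ℚ) : ℝ) - Real.log ((1 + κ * (a * x + b) : ℚ) : ℝ) ≤
        Real.log ((1 + κ * y : ℚ) : ℝ) - Real.log ((1 + κ * x : ℚ) : ℝ) := by
      intro a b x y hab hx hxy hx' hy'
      have := log_ineq (pos _ hy') (pos _ hx) (pos _ (hx.trans hxy)) (pos _ hx') (by
        have : 0 ≤ κ * (y - x) * (κ * b - (a - 1)) :=
          mul_nonneg (mul_nonneg hκ0.le (by linarith)) (by linarith)
        nlinarith)
      linarith
    refine ⟨fun x => Real.log ((1 + κ * x : ℚ) : ℝ), ?_, ?_, ?_⟩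
    · intro x y hx hxy hy
      exact log_strict (pos x hx) (by nlinarith)
    · intro x y hx hxy hy
      exact gen a1 b1 x y e1.le hx hxy (rA x hx (by linarith)).1 (rA y (by linarith) hy).1
    · intro x y hx hxy hy
      exact gen a2 b2 x y e2 (by linarith) hxy (rB x hx (by linarith)).1 (rB y (by linarith) hy).1
  push Not at g1
  by_cases g2 : 1 < a2
  · have hb2 : b2 < 0 := by linarith
    obtain ⟨κ, hκ⟩ : ∃ κ, κ = (a2 - 1) / b2 := ⟨_, rfl⟩
    have hκ0 : κ < 0 := by rw [hκ]; exact div_neg_of_pos_of_neg (by linarith) hb2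
    have e1 : a2 - 1 = κ * b2 := by rw [hκ, div_mul_cancel₀ _ hb2.ne]
    have e2 : a1 - 1 ≤ κ * b1 := by
      have : κ * b1 = (a2 - 1) * b1 / b2 := by rw [hκ]; ring
      rw [this, le_div_iff_of_neg hb2]; exact hk
    have hκ1 : -1 < κ := by nlinarith
    have pos : ∀ x, 0 ≤ x → x ≤ 1 → 0 < 1 + κ * x := fun x hx hx1 => by nlinarith
    have gen : ∀ a b x y : ℚ, a - 1 ≤ κ * b → 0 ≤ x → x ≤ y → y ≤ 1 →
        (0 ≤ a * x + b ∧ a * x + b ≤ 1) → (0 ≤ a * y + b ∧ a * y + b ≤ 1) →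
        -Real.log ((1 + κ * (a * y + b) : ℚ) : ℝ) - -Real.log ((1 + κ * (a * x + b) : ℚ) : ℝ) ≤
        -Real.log ((1 + κ * y : ℚ) : ℝ) - -Real.log ((1 + κ * x : ℚ) : ℝ) := by
      intro a b x y hab hx hxy hy hx' hy'
      have := log_ineq (pos _ (hx.trans hxy) hy) (pos _ hx'.1 hx'.2) (pos _ hy'.1 hy'.2)
        (pos _ hx (hxy.trans hy)) (by
        have : 0 ≤ (-κ) * (y - x) * (κ * b - (a - 1)) :=
          mul_nonneg (mul_nonneg (by linarith) (by linarith)) (by linarith)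
        nlinarith)
      linarith
    refine ⟨fun x => -Real.log ((1 + κ * x : ℚ) : ℝ), ?_, ?_, ?_⟩
    · intro x y hx hxy hy
      exact neg_lt_neg (log_strict (pos y (by linarith) hy) (by nlinarith))
    · intro x y hx hxy hy
      exact gen a1 b1 x y e2 hx hxy (by linarith) (rA x hx (by linarith)) (rA y (by linarith) hy)
    · intro x y hx hxy hy
      exact gen a2 b2 x y e1.le (by linarith) hxy hy (rB x hx (by linarith)) (rB y (by linarith) hy)
  push Not at g2
  refine ⟨fun x => (x : ℝ), ?_, ?_, ?_⟩
  · intro x y _ hxy _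
    beta_reduce
    exact_mod_cast hxy
  · intro x y hx hxy hy
    have : (a1 * y + b1) - (a1 * x + b1) ≤ y - x := by nlinarith
    beta_reduce
    exact_mod_cast this
  · intro x y hx hxy hy
    have : (a2 * y + b2) - (a2 * x + b2) ≤ y - x := by nlinarith
    beta_reduce
    exact_mod_cast this

/-- every iterate hits `[p,q)` -/
def QQ (f : ℚ → ℚ) (p q : ℚ) : Prop :=
  ∀ m : ℕ, ∃ x ∈ Set.Ico (0 : ℚ) 1, p ≤ f^[m] x ∧ f^[m] x < q

theorem Prom.QQ_split (P : Prom a1 b1 a2 b2 c) {p q t : ℚ} (h : QQ (pam2 a1 b1 a2 b2 c) p q) :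
    QQ (pam2 a1 b1 a2 b2 c) p t ∨ QQ (pam2 a1 b1 a2 b2 c) t q := by
  by_contra hc
  push Not at hc
  obtain ⟨h1, h2⟩ := hc
  unfold QQ at h1 h2
  push Not at h1 h2
  obtain ⟨m1, h1⟩ := h1
  obtain ⟨m2, h2⟩ := h2
  obtain ⟨x, hx, hx1, hx2⟩ := h (m1 + m2)
  by_cases ht : (pam2 a1 b1 a2 b2 c)^[m1 + m2] x < t
  · have := h1 _ (P.iter_mem hx m2)
    rw [← Function.iterate_add_apply] at this
    exact absurd ht (not_lt.2 (this hx1))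
  · have := h2 _ (P.iter_mem hx m1)
    rw [← Function.iterate_add_apply, add_comm m2 m1] at this
    exact absurd hx2 (not_lt.2 (this (not_lt.1 ht)))

/-- never returning -/
def NV (f : ℚ → ℚ) (u v : ℚ) : Prop :=
  ∀ z ∈ Set.Ico (0 : ℚ) 1, u ≤ z → z < v → ∀ k, 0 < k → ¬ (u ≤ f^[k] z ∧ f^[k] z < v)

def Av (f : ℚ → ℚ) (d u v : ℚ) : Prop :=
  d ∈ Set.Ico (0 : ℚ) 1 → ∀ m, ¬ (u < f^[m] d ∧ f^[m] d < v)

theorem Prom.avoid (P : Prom a1 b1 a2 b2 c) {u v : ℚ} (d : ℚ) (hN : NV (pam2 a1 b1 a2 b2 c) u v)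
    (h : QQ (pam2 a1 b1 a2 b2 c) u v) :
    ∃ u' v', u ≤ u' ∧ v' ≤ v ∧ QQ (pam2 a1 b1 a2 b2 c) u' v' ∧
      Av (pam2 a1 b1 a2 b2 c) d u' v' := by
  by_cases hd : Av (pam2 a1 b1 a2 b2 c) d u v
  · exact ⟨u, v, le_rfl, le_rfl, h, hd⟩
  unfold Av at hd
  push Not at hd
  obtain ⟨hd1, m, hm1, hm2⟩ := hd
  have huniq : ∀ k, u < (pam2 a1 b1 a2 b2 c)^[k] d → (pam2 a1 b1 a2 b2 c)^[k] d < v → k = m := by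
    intro k hk1 hk2
    rcases lt_trichotomy k m with hlt | heq | hlt
    · exfalso
      refine hN _ (P.iter_mem hd1 k) hk1.le hk2 (m - k) (by omega) ?_
      rw [← Function.iterate_add_apply, show m - k + k = m by omega]
      exact ⟨hm1.le, hm2⟩
    · exact heq
    · exfalso
      refine hN _ (P.iter_mem hd1 m) hm1.le hm2 (k - m) (by omega) ?_
      rw [← Function.iterate_add_apply, show k - m + m = k by omega]
      exact ⟨hk1.le, hk2⟩
  rcases P.QQ_split (t := (pam2 a1 b1 a2 b2 c)^[m] d) h with h' | h'
  · refine ⟨u, _, le_rfl, hm2.le, h', fun _ k hk => ?_⟩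
    have := huniq k hk.1 (hk.2.trans hm2)
    subst this
    exact lt_irrefl _ hk.2
  · refine ⟨_, v, hm1.le, le_rfl, h', fun _ k hk => ?_⟩
    have := huniq k (hm1.trans hk.1) hk.2
    subst this
    exact lt_irrefl _ hk.1

theorem NV.mono {f : ℚ → ℚ} {u v u' v' : ℚ} (h : NV f u v) (h1 : u ≤ u') (h2 : v' ≤ v) :
    NV f u' v' := fun z hz a b k hk e =>
  h z hz (h1.trans a) (b.trans_le h2) k hk ⟨h1.trans e.1, e.2.trans_le h2⟩

theorem Av.mono {f : ℚ → ℚ} {d u v u' v' : ℚ} (h : Av f d u v) (h1 : u ≤ u') (h2 : v' ≤ v) :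
    Av f d u' v' := fun hd m e => h hd m ⟨h1.trans_lt e.1, e.2.trans_le h2⟩

theorem CaseB.chain (H : CaseB a1 b1 a2 b2 c) {Φ : ℚ → ℝ}
    (hA : ∀ x y, 0 ≤ x → x ≤ y → y ≤ c → Φ (a1 * y + b1) - Φ (a1 * x + b1) ≤ Φ y - Φ x)
    (hB : ∀ x y, c ≤ x → x ≤ y → y ≤ 1 → Φ (a2 * y + b2) - Φ (a2 * x + b2) ≤ Φ y - Φ x)
    {u v : ℚ} (hu : 0 ≤ u) (hv : v ≤ 1) (huv : u < v)
    (d1 : Av (pam2 a1 b1 a2 b2 c) b1 u v) (d2 : Av (pam2 a1 b1 a2 b2 c) (a2 * c + b2) u v)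
    (d3 : Av (pam2 a1 b1 a2 b2 c) (a2 + b2) u v) (d4 : Av (pam2 a1 b1 a2 b2 c) (a1 * c + b1) u v)
    (hQ : QQ (pam2 a1 b1 a2 b2 c) u v) (m : ℕ) :
    ∃ p q, 0 ≤ p ∧ p < q ∧ q ≤ 1 ∧
      (∀ x ∈ Set.Ico (0 : ℚ) 1, (u ≤ (pam2 a1 b1 a2 b2 c)^[m] x ∧ (pam2 a1 b1 a2 b2 c)^[m] x < v) ↔
        p ≤ x ∧ x < q) ∧
      (∀ x y, p ≤ x → x < y → y < q →
        (pam2 a1 b1 a2 b2 c)^[m] x < (pam2 a1 b1 a2 b2 c)^[m] y) ∧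
      Φ v - Φ u ≤ Φ q - Φ p := by
  obtain ⟨f1, f2, f3, f4, f5⟩ := H.facts
  have hc0 := H.P.c0
  have hc1 := H.P.c1
  have ha1 := H.ha1
  have ha2 := H.ha2
  induction m with
  | zero => exact ⟨u, v, hu, huv, hv, fun x hx => Iff.rfl, fun x y _ h _ => h, le_rfl⟩
  | succ m ih =>
    obtain ⟨p, q, hp, hpq, hq, hiff, hmono, hΦ⟩ := ih
    have noD : ∀ d, Av (pam2 a1 b1 a2 b2 c) d u v → ¬ (p < d ∧ d < q) := by
      rintro d hd ⟨hd1, hd2⟩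
      have hdI : d ∈ Set.Ico (0 : ℚ) 1 := ⟨by linarith, by linarith⟩
      have hpI : p ∈ Set.Ico (0 : ℚ) 1 := ⟨hp, by linarith⟩
      have e1 := (hiff p hpI).2 ⟨le_rfl, hpq⟩
      have e2 := (hiff d hdI).2 ⟨hd1.le, hd2⟩
      have e3 := hmono p d le_rfl hd1 hd2
      exact hd hdI m ⟨by linarith, e2.2⟩
    obtain ⟨x, hx, hx1, hx2⟩ := hQ (m + 1)
    have hfx := (hiff _ (H.P.maps x hx)).1
      (by rw [← Function.iterate_succ_apply]; exact ⟨hx1, hx2⟩)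
    have n1 := noD _ d1
    have n2 := noD _ d2
    have n3 := noD _ d3
    have n4 := noD _ d4
    by_cases hxc : x < c
    · rw [pamA hx.1 hxc] at hfx
      have g1 : b1 ≤ p := by
        by_contra hh
        push Not at hh
        exact n1 ⟨hh, by nlinarith [hx.1]⟩
      have g2 : q ≤ a1 * c + b1 := by
        by_contra hh
        push Not at hh
        exact n4 ⟨by nlinarith, hh⟩
      refine ⟨(p - b1) / a1, (q - b1) / a1, div_nonneg (by linarith) ha1.le,
        by gcongr, ?_, ?_, ?_, ?_⟩
      · rw [div_le_one ha1]; nlinarith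
      · intro y hy
        rw [Function.iterate_succ_apply, hiff _ (H.P.maps y hy), div_le_iff₀ ha1, lt_div_iff₀ ha1]
        by_cases hyc : y < c
        · rw [pamA hy.1 hyc]
          constructor <;> rintro ⟨_, _⟩ <;> constructor <;> linarith
        · rw [pamB (not_lt.1 hyc) hy.2]
          have hy2 := hy.2
          push Not at hyc
          constructor
          · rintro ⟨_, _⟩; exfalso; nlinarith
          · rintro ⟨_, _⟩; exfalso; nlinarith
      · intro y z hy hyz hz
        rw [div_le_iff₀ ha1] at hy
        rw [lt_div_iff₀ ha1] at hz
        have hy0 : 0 ≤ y := by by_contra hh; push Not at hh; nlinarith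
        have hzc : z < c := by by_contra hh; push Not at hh; nlinarith
        rw [Function.iterate_succ_apply, Function.iterate_succ_apply, pamA hy0 (by linarith),
          pamA (by linarith) hzc]
        exact hmono _ _ (by linarith) (by nlinarith) (by linarith)
      · have := hA ((p - b1) / a1) ((q - b1) / a1) (div_nonneg (by linarith) ha1.le)
          (by gcongr) (by rw [div_le_iff₀ ha1]; linarith)
        rw [show a1 * ((p - b1) / a1) + b1 = p by field_simp; ring,
          show a1 * ((q - b1) / a1) + b1 = q by field_simp; ring] at this
        linarith
    · rw [pamB (not_lt.1 hxc) hx.2] at hfx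
      push Not at hxc
      have hx1 := hx.2
      have g1 : a2 * c + b2 ≤ p := by
        by_contra hh
        push Not at hh
        exact n2 ⟨hh, by nlinarith [hx.1]⟩
      have g2 : q ≤ a2 + b2 := by
        by_contra hh
        push Not at hh
        exact n3 ⟨by nlinarith, hh⟩
      have g3 : c ≤ (p - b2) / a2 := by rw [le_div_iff₀ ha2]; linarith
      have g4 : (q - b2) / a2 ≤ 1 := by rw [div_le_one ha2]; linarith
      refine ⟨(p - b2) / a2, (q - b2) / a2, by linarith,
        by gcongr, g4, ?_, ?_, ?_⟩
      · intro y hy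
        rw [Function.iterate_succ_apply, hiff _ (H.P.maps y hy), div_le_iff₀ ha2, lt_div_iff₀ ha2]
        by_cases hyc : y < c
        · rw [pamA hy.1 hyc]
          have hy2 := hy.1
          constructor
          · rintro ⟨_, _⟩; exfalso; nlinarith
          · rintro ⟨_, _⟩; exfalso; nlinarith
        · rw [pamB (not_lt.1 hyc) hy.2]
          constructor <;> rintro ⟨_, _⟩ <;> constructor <;> linarith
      · intro y z hy hyz hz
        have hyc : c ≤ y := by linarith
        have hz1 : z < 1 := by linarith
        rw [div_le_iff₀ ha2] at hy
        rw [lt_div_iff₀ ha2] at hz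
        rw [Function.iterate_succ_apply, Function.iterate_succ_apply, pamB hyc (by linarith),
          pamB (by linarith) hz1]
        exact hmono _ _ (by linarith) (by nlinarith) (by linarith)
      · have := hB ((p - b2) / a2) ((q - b2) / a2) g3 (by gcongr) g4
        rw [show a2 * ((p - b2) / a2) + b2 = p by field_simp; ring,
          show a2 * ((q - b2) / a2) + b2 = q by field_simp; ring] at this
        linarith

theorem CaseB.no_wander (H : CaseB a1 b1 a2 b2 c) {u v : ℚ} (hu : 0 ≤ u) (hv : v ≤ 1)
    (hN : NV (pam2 a1 b1 a2 b2 c) u v) (hQ : QQ (pam2 a1 b1 a2 b2 c) u v) : False := by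
  obtain ⟨u1, v1, i1, j1, Q1, D1⟩ := H.P.avoid b1 hN hQ
  have N1 := hN.mono i1 j1
  obtain ⟨u2, v2, i2, j2, Q2, D2⟩ := H.P.avoid (a2 * c + b2) N1 Q1
  have N2 := N1.mono i2 j2
  obtain ⟨u3, v3, i3, j3, Q3, D3⟩ := H.P.avoid (a2 + b2) N2 Q2
  have N3 := N2.mono i3 j3
  obtain ⟨u4, v4, i4, j4, Q4, D4⟩ := H.P.avoid (a1 * c + b1) N3 Q3
  have N4 := N3.mono i4 j4
  have D3' := D3.mono i4 j4
  have D2' := (D2.mono i3 j3).mono i4 j4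
  have D1' := ((D1.mono i2 j2).mono i3 j3).mono i4 j4
  have hu4 : 0 ≤ u4 := by linarith
  have hv4 : v4 ≤ 1 := by linarith
  have huv4 : u4 < v4 := by
    obtain ⟨x, _, h1, h2⟩ := Q4 0
    exact h1.trans_lt h2
  obtain ⟨Φ, hΦ, hA, hB⟩ := H.potential
  choose p q hp hpq hq hiff hmono hΦ' using
    H.chain hA hB hu4 hv4 huv4 D1' D2' D3' D4 Q4
  have mono' : ∀ x y, 0 ≤ x → x ≤ y → y ≤ 1 → Φ x ≤ Φ y := by
    intro x y h0 h1 h2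
    rcases h1.eq_or_lt with rfl | h
    · exact le_rfl
    · exact (hΦ x y h0 h h2).le
  set ε := Φ v4 - Φ u4 with hε
  have hε0 : 0 < ε := sub_pos.2 (hΦ _ _ hu4 huv4 hv4)
  obtain ⟨N, hNN⟩ : ∃ N : ℕ, (Φ 1 - Φ 0) / ε < N := exists_nat_gt _
  have hnn : ∀ m, 0 ≤ (Φ (p m) - Φ 0) / ε := fun m =>
    div_nonneg (sub_nonneg.2 (mono' _ _ le_rfl (hp m) ((hpq m).le.trans (hq m)))) hε0.le
  have hbd : ∀ m, ⌊(Φ (p m) - Φ 0) / ε⌋₊ < N := by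
    intro m
    rw [Nat.floor_lt (hnn m)]
    refine lt_of_le_of_lt ?_ hNN
    gcongr
    exact mono' _ _ (hp m) ((hpq m).le.trans (hq m)) le_rfl
  obtain ⟨m, m', hne, he⟩ := Finite.exists_ne_map_eq_of_infinite
    (fun m : ℕ => (⟨⌊(Φ (p m) - Φ 0) / ε⌋₊, hbd m⟩ : Fin N))
  have he : ⌊(Φ (p m) - Φ 0) / ε⌋₊ = ⌊(Φ (p m') - Φ 0) / ε⌋₊ := congrArg Fin.val he
  have close : ∀ m m', ⌊(Φ (p m) - Φ 0) / ε⌋₊ = ⌊(Φ (p m') - Φ 0) / ε⌋₊ → p m' < q m := by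
    intro m m' he
    by_contra hh
    push Not at hh
    have e1 := mono' _ _ ((hp m).trans (hpq m).le) hh ((hpq m').le.trans (hq m'))
    have e2 := hΦ' m
    have e3 := Nat.floor_le (hnn m)
    have e4 := Nat.lt_floor_add_one ((Φ (p m') - Φ 0) / ε)
    rw [← he] at e4
    rw [le_div_iff₀ hε0] at e3
    rw [div_lt_iff₀ hε0] at e4
    nlinarith
  have c1 := close m m' he
  have c2 := close m' m he.symm
  have fin : ∀ m m', m < m' → ∀ x, p m ≤ x → x < q m → p m' ≤ x → x < q m' → False := by
    intro m m' hlt x h1 h2 h3 h4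
    have hx : x ∈ Set.Ico (0 : ℚ) 1 := ⟨(hp m).trans h1, h2.trans_le (hq m)⟩
    have e1 := (hiff m x hx).2 ⟨h1, h2⟩
    have e2 := (hiff m' x hx).2 ⟨h3, h4⟩
    refine N4 _ (H.P.iter_mem hx m) e1.1 e1.2 (m' - m) (by omega) ?_
    rw [← Function.iterate_add_apply, show m' - m + m = m' by omega]
    exact e2
  have k1 : p m ≤ max (p m) (p m') := le_max_left _ _
  have k2 : p m' ≤ max (p m) (p m') := le_max_right _ _
  have k3 : max (p m) (p m') < q m := max_lt (hpq m) c1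
  have k4 : max (p m) (p m') < q m' := max_lt c2 (hpq m')
  rcases lt_or_gt_of_ne hne with h | h
  · exact fin m m' h _ k1 k3 k2 k4
  · exact fin m' m h _ k2 k4 k1 k3

theorem cert_complete {a1 b1 a2 b2 c x0 u v : ℚ} (P : Prom a1 b1 a2 b2 c)
    (hx : x0 ∈ Set.Ico (0 : ℚ) 1) (hu : 0 ≤ u) (_huv : u < v) (hv : v ≤ 1)
    (h : ∀ k, ¬ hitP a1 b1 a2 b2 c x0 u v k) :
    (∃ n p L, cert1 a1 b1 a2 b2 c x0 u v n p L) ∨ ∃ m, cert2 a1 b1 a2 b2 c x0 u v m := by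
  by_cases he : (∀ x y, 0 ≤ x → x < c → c ≤ y → y < 1 → a1 * x + b1 < a2 * y + b2) ∨ a1 < 0 ∨ a2 < 0
  · exact Or.inl (cert1_of_evPer P hx h (evPer_easy P hx he))
  push Not at he
  have ha1 : 0 < a1 := lt_of_le_of_ne he.2.1 P.a1_ne.symm
  have ha2 : 0 < a2 := lt_of_le_of_ne he.2.2 P.a2_ne.symm
  have H : CaseB a1 b1 a2 b2 c := by
    refine ⟨P, ha1, ha2, ?_⟩
    rcases P.dichotomy with hd | hd
    · exfalso
      obtain ⟨x, y, h1, h2, h3, h4, h5⟩ := he.1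
      exact absurd (hd x y h1 h2 h3 h4) (not_lt.2 h5)
    · exact hd
  by_cases hN : NV (pam2 a1 b1 a2 b2 c) u v
  · right
    by_contra hc
    push Not at hc
    exact H.no_wander hu hv hN fun m => exists_of_not_cert2 P ha1 ha2 hu hv h m (hc m)
  · left
    unfold NV at hN
    push Not at hN
    obtain ⟨z, hz, hz1, hz2, k, hk, hk1, hk2⟩ := hN
    exact cert1_of_evPer P hx h (H.evPer_of_return hx h hz hk ⟨hz1, hz2⟩ ⟨hk1, hk2⟩)

theorem ofNat_rat_surj (q : ℚ) : ∃ n, Denumerable.ofNat ℚ n = q :=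
  ⟨_, Denumerable.ofNat_encode q⟩

theorem exists_halting (a1 b1 a2 b2 c x0 u v : ℚ) : ∃ k, stopP a1 b1 a2 b2 c x0 u v k := by
  by_cases hb : ∃ x y, badP a1 b1 a2 b2 c x0 u v x y
  · obtain ⟨x, y, h⟩ := hb
    obtain ⟨n, rfl⟩ := ofNat_rat_surj x
    obtain ⟨m, rfl⟩ := ofNat_rat_surj y
    refine ⟨Nat.pair n m, Or.inr (Or.inr (Or.inr ?_))⟩
    rw [Nat.unpair_pair]; exact h
  by_cases hh : ∃ k, hitP a1 b1 a2 b2 c x0 u v k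
  · obtain ⟨k, h⟩ := hh
    exact ⟨k, Or.inl h⟩
  push Not at hh
  have hb' : ∀ x y, ¬ badP a1 b1 a2 b2 c x0 u v x y := fun x y h => hb ⟨x, y, h⟩
  simp only [badP, inUnit, not_or, not_not] at hb'
  have h0 := hb' 0 0
  have P : Prom a1 b1 a2 b2 c := by
    refine ⟨h0.1, h0.2.1, ?_, ?_⟩
    · intro x hx
      by_contra hc
      exact (hb' x x).2.2.2.2.2.2.1 ⟨⟨hx.1, hx.2⟩, hc⟩
    · intro x hx y hy hxy
      by_contra hc
      exact (hb' x y).2.2.2.2.2.2.2 ⟨hx, hy, hc, hxy⟩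
  rcases cert_complete P h0.2.2.1 h0.2.2.2.1 h0.2.2.2.2.1 h0.2.2.2.2.2.1 hh with ⟨n, p, L, h⟩ | ⟨m, h⟩
  · obtain ⟨l, rfl⟩ := ofNat_rat_surj L
    refine ⟨Nat.pair n (Nat.pair p l), Or.inr (Or.inl ?_)⟩
    simp only [Nat.unpair_pair]; exact h
  · exact ⟨m, Or.inr (Or.inr (Or.inl h))⟩

/-- Point-to-interval reachability is decidable for injective two-interval PAM. -/
theorem pam_point_to_interval_reachability_decidable :
    ∃ F : ℚ × ℚ × ℚ × ℚ × ℚ × ℚ × ℚ × ℚ → Bool, Computable F ∧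
      ∀ a1 b1 a2 b2 c x0 u v : ℚ,
        0 < c → c < 1 →
        (∀ x ∈ Set.Ico (0 : ℚ) 1, pam2 a1 b1 a2 b2 c x ∈ Set.Ico (0 : ℚ) 1) →
        Set.InjOn (pam2 a1 b1 a2 b2 c) (Set.Ico (0 : ℚ) 1) →
        x0 ∈ Set.Ico (0 : ℚ) 1 →
        0 ≤ u → u < v → v ≤ 1 →
        (F (a1, b1, a2, b2, c, x0, u, v) = true ↔
          ∃ n : ℕ, u ≤ (pam2 a1 b1 a2 b2 c)^[n] x0 ∧ (pam2 a1 b1 a2 b2 c)^[n] x0 < v) := by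
  let I := ℚ × ℚ × ℚ × ℚ × ℚ × ℚ × ℚ × ℚ
  have s1 : Computable (fun t : I × ℕ => t.1.1) := Computable.fst.comp Computable.fst
  have t1 : Computable (fun t : I × ℕ => t.1.2) := Computable.snd.comp Computable.fst
  have s2 : Computable (fun t : I × ℕ => t.1.2.1) := Computable.fst.comp t1
  have t2 : Computable (fun t : I × ℕ => t.1.2.2) := Computable.snd.comp t1
  have s3 : Computable (fun t : I × ℕ => t.1.2.2.1) := Computable.fst.comp t2
  have t3 : Computable (fun t : I × ℕ => t.1.2.2.2) := Computable.snd.comp t2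
  have s4 : Computable (fun t : I × ℕ => t.1.2.2.2.1) := Computable.fst.comp t3
  have t4 : Computable (fun t : I × ℕ => t.1.2.2.2.2) := Computable.snd.comp t3
  have s5 : Computable (fun t : I × ℕ => t.1.2.2.2.2.1) := Computable.fst.comp t4
  have t5 : Computable (fun t : I × ℕ => t.1.2.2.2.2.2) := Computable.snd.comp t4
  have s6 : Computable (fun t : I × ℕ => t.1.2.2.2.2.2.1) := Computable.fst.comp t5
  have t6 : Computable (fun t : I × ℕ => t.1.2.2.2.2.2.2) := Computable.snd.comp t5
  have s7 : Computable (fun t : I × ℕ => t.1.2.2.2.2.2.2.1) := Computable.fst.comp t6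
  have s8 : Computable (fun t : I × ℕ => t.1.2.2.2.2.2.2.2) := Computable.snd.comp t6
  have s9 : Computable (fun t : I × ℕ => t.2) := Computable.snd
  obtain ⟨T, hT, hT'⟩ := cStop s1 s2 s3 s4 s5 s6 s7 s8 s9
  obtain ⟨H, hH, hH'⟩ := cHit s1 s2 s3 s4 s5 s6 s7 s8 s9
  have hex : ∀ t : I, ∃ n, T (t, n) = true := by
    rintro ⟨a1, b1, a2, b2, c, x0, u, v⟩
    obtain ⟨k, hk⟩ := exists_halting a1 b1 a2 b2 c x0 u v
    exact ⟨k, (hT' _).2 hk⟩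
  have hfind := computable_find (fun t n => T (t, n)) hT hex
  refine ⟨fun t => H (t, Nat.find (hex t)), hH.comp (Computable.id.pair hfind), ?_⟩
  intro a1 b1 a2 b2 c x0 u v hc0 hc1 hm hi hx hu huv hv
  have P : Prom a1 b1 a2 b2 c := ⟨hc0, hc1, hm, hi⟩
  have hs := (hT' _).1 (Nat.find_spec (hex (a1, b1, a2, b2, c, x0, u, v)))
  rw [hH']
  generalize Nat.find (hex (a1, b1, a2, b2, c, x0, u, v)) = k at hs ⊢
  constructor
  · intro h; exact ⟨k, h⟩
  · rintro ⟨n, hn⟩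
    rcases hs with h | h | h | h
    · exact h
    · exact absurd hn (cert1_sound P hx h n)
    · exact absurd hn (cert2_sound P hx h n)
    · exfalso
      rcases h with h | h | h | h | h | h | h | h
      · exact h hc0
      · exact h hc1
      · exact h hx
      · exact h hu
      · exact h huv
      · exact h hv
      · exact h.2 (hm _ h.1)
      · exact h.2.2.1 (hi h.1 h.2.1 h.2.2.2)
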